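/- Under the stated assumptions, there exist a coercive, locally Lipschitz function H̄ : ℝ → ℝ (i.e. H̄(θ) → ∞ as |θ| → ∞ and H̄ is Lipschitz on every compact interval) and a measurable set Ω₀ ⊆ Ω with ℙ(Ω₀) = 1 such that for every ω ∈ Ω₀, every θ ∈ ℝ and every T, M > 0, sup_{t∈[0,T]} sup_{x∈[−M,M]} |u_θ^ε(t,x,ω) − t·H̄(θ) − θx| → 0 as ε → 0⁺; that is, u_θ^ε(·,·,ω) converges locally uniformly on [0,∞) × ℝ to ū_θ(t,x) = t·H̄(θ) + θx. -/

import Mathlib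

open MeasureTheory Filter Set

def IsViscositySubsolution (alpha : ℝ → ℝ) (h : ℝ → ℝ → ℝ) (v : ℝ → ℝ → ℝ) : Prop :=
  ∀ t₀ x₀ : ℝ, 0 < t₀ →
    ∀ φ : ℝ × ℝ → ℝ, ContDiffOn ℝ 2 φ {q : ℝ × ℝ | 0 < q.1} →
      IsLocalMax (fun q : ℝ × ℝ => v q.1 q.2 - φ q) (t₀, x₀) →
      deriv (fun t => φ (t, x₀)) t₀ ≤
        alpha x₀ * deriv (deriv fun x => φ (t₀, x)) x₀ +
          h (deriv (fun x => φ (t₀, x)) x₀) x₀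

def IsViscositySupersolution (alpha : ℝ → ℝ) (h : ℝ → ℝ → ℝ) (v : ℝ → ℝ → ℝ) : Prop :=
  ∀ t₀ x₀ : ℝ, 0 < t₀ →
    ∀ φ : ℝ × ℝ → ℝ, ContDiffOn ℝ 2 φ {q : ℝ × ℝ | 0 < q.1} →
      IsLocalMin (fun q : ℝ × ℝ => v q.1 q.2 - φ q) (t₀, x₀) →
      alpha x₀ * deriv (deriv fun x => φ (t₀, x)) x₀ +
          h (deriv (fun x => φ (t₀, x)) x₀) x₀ ≤
        deriv (fun t => φ (t, x₀)) t₀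

def IsViscositySolution (alpha : ℝ → ℝ) (h : ℝ → ℝ → ℝ) (v : ℝ → ℝ → ℝ) : Prop :=
  IsViscositySubsolution alpha h v ∧ IsViscositySupersolution alpha h v

structure HJSetting {Ω : Type} [MeasurableSpace Ω] (P : Measure Ω) (τ : ℝ → Ω → Ω)
    (a : ℝ → Ω → ℝ) (H : ℝ → ℝ → Ω → ℝ) (G_L G_U : ℝ → ℝ) : Prop where
  prob : IsProbabilityMeasure P
  meas_tau : Measurable fun q : ℝ × Ω => τ q.1 q.2
  mp_tau : ∀ x, MeasurePreserving (τ x) P P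
  tau_zero : ∀ ω, τ 0 ω = ω
  tau_add : ∀ x y ω, τ (x + y) ω = τ x (τ y ω)
  ergodic : ∀ A : Set Ω, MeasurableSet A → (∀ x, τ x ⁻¹' A = A) → P A = 0 ∨ P A = 1
  meas_a : Measurable fun q : ℝ × Ω => a q.1 q.2
  a_pos : ∀ x ω, 0 < a x ω
  a_le_one : ∀ x ω, a x ω ≤ 1
  a_stat : ∀ x ω, a x ω = a 0 (τ x ω)
  a_sqrt_lip : ∃ κ > (0:ℝ), ∀ x ω, |Real.sqrt (a x ω) - Real.sqrt (a 0 ω)| ≤ κ * |x|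
  meas_H : Measurable fun q : ℝ × ℝ × Ω => H q.1 q.2.1 q.2.2
  H_stat : ∀ p x ω, H p x ω = H p 0 (τ x ω)
  GL_cont : Continuous G_L
  GU_cont : Continuous G_U
  GL_even : ∀ p, G_L (-p) = G_L p
  GU_even : ∀ p, G_U (-p) = G_U p
  GL_mono : MonotoneOn G_L (Ici 0)
  GU_mono : MonotoneOn G_U (Ici 0)
  GL_coercive : Tendsto G_L atTop atTop
  GU_coercive : Tendsto G_U atTop atTop
  H_lower : ∀ p ω, G_L p ≤ H p 0 ω
  H_upper : ∀ p ω, H p 0 ω ≤ G_U p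
  H_lip : ∀ R > (0:ℝ), ∃ K > (0:ℝ), ∀ p q ω, |p| ≤ R → |q| ≤ R →
      |H p 0 ω - H q 0 ω| ≤ K * |p - q|
  H_mod : ∀ R > (0:ℝ), ∃ m : ℝ → ℝ, (∀ r, 0 ≤ m r) ∧ MonotoneOn m (Ici 0) ∧
      Tendsto m (nhdsWithin 0 (Ioi 0)) (nhds 0) ∧
      ∀ p x ω, |p| ≤ R → |H p x ω - H p 0 ω| ≤ m |x|

/-- A scalar vector field, continuous in the time variable, and bounded and Lipschitz in the state
variable locally uniformly in time. -/
structure IsTameField (v : ℝ → ℝ → ℝ) : Prop where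
  cont : ∀ p, Continuous fun x => v x p
  tame : ∀ T : ℝ, ∃ (L : NNReal) (B : ℝ), 0 ≤ B ∧ ∀ x, |x| ≤ T →
    LipschitzWith L (v x) ∧ ∀ p, |v x p| ≤ B

/-- `g` is a global solution of the equation with right-hand side `v x g`. -/
def IsGlobalSol (v : ℝ → ℝ → ℝ) (g : ℝ → ℝ) : Prop :=
  ∀ x, HasDerivAt g (v x (g x)) x

theorem IsGlobalSol.continuous {v : ℝ → ℝ → ℝ} {g : ℝ → ℝ} (hg : IsGlobalSol v g) :
    Continuous g :=
  continuous_iff_continuousAt.2 fun x => (hg x).continuousAt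

theorem IsGlobalSol.eq_of_eq {v : ℝ → ℝ → ℝ} (hv : IsTameField v) {g h : ℝ → ℝ}
    (hg : IsGlobalSol v g) (hh : IsGlobalSol v h) {x₀ : ℝ} (h0 : g x₀ = h x₀) : g = h := by
  funext x
  obtain ⟨L, B, -, hL⟩ := hv.tame (|x| + |x₀| + 1)
  have key := ODE_solution_unique_of_mem_Icc (v := v) (s := fun _ => univ) (K := L)
    (a := -(|x| + |x₀| + 1)) (b := |x| + |x₀| + 1) (t₀ := x₀) (f := g) (g := h)
    (fun t ht => (hL t (abs_le.2 ⟨ht.1.le, ht.2.le⟩)).1.lipschitzOnWith)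
    ⟨by have := neg_abs_le x₀; have := abs_nonneg x; linarith,
      by have := le_abs_self x₀; have := abs_nonneg x; linarith⟩
    hg.continuous.continuousOn (fun t _ => hg t) (fun _ _ => mem_univ _)
    hh.continuous.continuousOn (fun t _ => hh t) (fun _ _ => mem_univ _) h0
  exact key ⟨by have := neg_abs_le x; have := abs_nonneg x₀; linarith,
      by have := le_abs_self x; have := abs_nonneg x₀; linarith⟩

theorem IsTameField.exists_local {v : ℝ → ℝ → ℝ} (hv : IsTameField v) (c : ℝ) (n : ℕ) :
    ∃ g : ℝ → ℝ, g 0 = c ∧ ∀ x ∈ Ioo (-(n + 1 : ℝ)) (n + 1), HasDerivAt g (v x (g x)) x := by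
  obtain ⟨L, B, hB, hL⟩ := hv.tame (n + 1)
  have h0 : (0 : ℝ) ∈ Icc (-(n + 1 : ℝ)) (n + 1) := ⟨by linarith, by positivity⟩
  have hp : IsPicardLindelof v (tmin := -(n + 1 : ℝ)) (tmax := n + 1) ⟨0, h0⟩ c
      (⟨B, hB⟩ * (n + 1)) 0 ⟨B, hB⟩ L := by
    refine ⟨fun t ht => (hL t (abs_le.2 ht)).1.lipschitzOnWith, fun p _ => (hv.cont p).continuousOn,
      fun t ht p _ => (hL t (abs_le.2 ht)).2 p, ?_⟩
    simp only [sub_zero, zero_sub, neg_neg, max_self, NNReal.coe_zero]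
    exact le_of_eq rfl
  obtain ⟨g, hg0, hg⟩ := hp.exists_eq_forall_mem_Icc_hasDerivWithinAt₀
  exact ⟨g, hg0, fun x hx => (hg x (Ioo_subset_Icc_self hx)).hasDerivAt (Icc_mem_nhds hx.1 hx.2)⟩

theorem IsTameField.exists_global {v : ℝ → ℝ → ℝ} (hv : IsTameField v) (c : ℝ) :
    ∃ g : ℝ → ℝ, g 0 = c ∧ IsGlobalSol v g := by
  choose G hG0 hG using hv.exists_local c
  have agree : ∀ m n : ℕ, m ≤ n → ∀ x ∈ Ioo (-(m + 1 : ℝ)) (m + 1), G m x = G n x := by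
    intro m n hmn x hx
    obtain ⟨L, B, -, hL⟩ := hv.tame (m + 1)
    have hmn' : (m : ℝ) ≤ n := by exact_mod_cast hmn
    have hm : (0 : ℝ) ≤ m := by positivity
    have hsub : ∀ t ∈ Ioo (-(m + 1 : ℝ)) (m + 1), t ∈ Ioo (-(n + 1 : ℝ)) (n + 1) :=
      fun t ht => ⟨by linarith [ht.1], by linarith [ht.2]⟩
    exact ODE_solution_unique_of_mem_Ioo (v := v) (s := fun _ => univ) (K := L)
      (a := -(m + 1 : ℝ)) (b := m + 1) (t₀ := 0)
      (fun t ht => (hL t (abs_le.2 ⟨ht.1.le, ht.2.le⟩)).1.lipschitzOnWith)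
      ⟨by linarith, by linarith⟩
      (fun t ht => ⟨hG m t ht, mem_univ _⟩) (fun t ht => ⟨hG n t (hsub t ht), mem_univ _⟩)
      (by rw [hG0, hG0]) hx
  have hmem : ∀ x : ℝ, x ∈ Ioo (-((⌈|x|⌉₊ : ℝ) + 1)) ((⌈|x|⌉₊ : ℝ) + 1) := by
    intro x
    have h1 := Nat.le_ceil |x|
    have h2 := abs_le.1 h1
    exact ⟨by linarith, by linarith⟩
  refine ⟨fun x => G ⌈|x|⌉₊ x, hG0 _, fun x => ?_⟩
  refine (hG _ x (hmem x)).congr_of_eventuallyEq ?_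
  filter_upwards [isOpen_Ioo.mem_nhds (hmem x)] with y hy
  have h1 : ⌈|y|⌉₊ ≤ ⌈|x|⌉₊ + 1 := by
    rw [Nat.ceil_le]
    push_cast
    exact abs_le.2 ⟨hy.1.le, hy.2.le⟩
  have e1 : G ⌈|y|⌉₊ y = G (⌈|x|⌉₊ + 1) y := agree _ _ h1 y (hmem y)
  have e2 : G ⌈|x|⌉₊ y = G (⌈|x|⌉₊ + 1) y := agree _ _ (Nat.le_succ _) y hy
  rw [e1, e2]

theorem IsGlobalSol.lt_of_le_of_field_lt {v w : ℝ → ℝ → ℝ} (hvw : ∀ x p, v x p < w x p)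
    {g h : ℝ → ℝ} (hg : IsGlobalSol v g) (hh : IsGlobalSol w h) {x₀ x : ℝ}
    (h0 : g x₀ ≤ h x₀) (hx : x₀ < x) : g x < h x := by
  have hle : ∀ y, x₀ ≤ y → g y ≤ h y := by
    intro y hy
    exact image_le_of_deriv_right_lt_deriv_boundary' (a := x₀) (b := y) hg.continuous.continuousOn
      (fun z _ => (hg z).hasDerivWithinAt) h0 hh.continuous.continuousOn
      (fun z _ => (hh z).hasDerivWithinAt) (fun z _ hz => by rw [hz]; exact hvw _ _) ⟨hy, le_rfl⟩
  refine lt_of_le_of_ne (hle x hx.le) fun he => ?_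
  have hd : HasDerivAt (fun y => h y - g y) (w x (h x) - v x (g x)) x := (hh x).sub (hg x)
  have hpos : 0 < w x (h x) - v x (g x) := by rw [he]; linarith [hvw x (h x)]
  have hs := (hasDerivAt_iff_tendsto_slope.1 hd).eventually (lt_mem_nhds hpos)
  have hs' : ∀ᶠ y in nhdsWithin x (Iio x), 0 < slope (fun y => h y - g y) x y :=
    hs.filter_mono (nhdsWithin_mono _ fun y hy => ne_of_lt hy)
  obtain ⟨y, hy, hyx⟩ := (hs'.and (Ioo_mem_nhdsLT hx)).exists
  rw [slope_def_field, he, sub_self, sub_zero] at hy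
  have h1 := hle y hyx.1.le
  have : (h y - g y) / (y - x) ≤ 0 :=
    div_nonpos_of_nonneg_of_nonpos (by linarith) (by linarith [hyx.2])
  linarith

theorem IsGlobalSol.dist_le {v w : ℝ → ℝ → ℝ} {T : ℝ} {L : NNReal} {ε : ℝ}
    (hL : ∀ x, |x| ≤ T → LipschitzWith L (v x)) (hvw : ∀ x, |x| ≤ T → ∀ p, |w x p - v x p| ≤ ε)
    {g h : ℝ → ℝ} (hg : IsGlobalSol v g) (hh : IsGlobalSol w h) {x : ℝ} (hx : |x| ≤ T) :
    |g x - h x| ≤ gronwallBound |g 0 - h 0| L ε |x| := by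
  have fwd : ∀ (v w : ℝ → ℝ → ℝ) (g h : ℝ → ℝ),
      (∀ x, |x| ≤ T → LipschitzWith L (v x)) → (∀ x, |x| ≤ T → ∀ p, |w x p - v x p| ≤ ε) →
      IsGlobalSol v g → IsGlobalSol w h → ∀ x, 0 ≤ x → x ≤ T →
      |g x - h x| ≤ gronwallBound |g 0 - h 0| L ε x := by
    intro v w g h hL hvw hg hh x hx0 hxT
    have key := dist_le_of_approx_trajectories_ODE_of_mem (v := v) (s := fun _ => univ) (K := L)
      (f := g) (g := h) (f' := fun t => v t (g t)) (g' := fun t => w t (h t)) (a := 0) (b := x)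
      (εf := 0) (εg := ε) (δ := |g 0 - h 0|)
      (fun t ht => (hL t (by rw [abs_of_nonneg ht.1]; linarith [ht.2])).lipschitzOnWith)
      hg.continuous.continuousOn (fun t _ => (hg t).hasDerivWithinAt) (fun t _ => by simp)
      (fun _ _ => mem_univ _)
      hh.continuous.continuousOn (fun t _ => (hh t).hasDerivWithinAt)
      (fun t ht => hvw t (by rw [abs_of_nonneg ht.1]; linarith [ht.2]) _)
      (fun _ _ => mem_univ _) le_rfl x ⟨hx0, le_rfl⟩
    simpa [Real.dist_eq] using key
  rcases le_total 0 x with h0 | h0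
  · rw [abs_of_nonneg h0] at hx ⊢
    exact fwd v w g h hL hvw hg hh x h0 hx
  · rw [abs_of_nonpos h0] at hx ⊢
    have rev : ∀ (v : ℝ → ℝ → ℝ) (g : ℝ → ℝ), IsGlobalSol v g →
        IsGlobalSol (fun x p => -v (-x) p) (fun x => g (-x)) := by
      intro v g hg x
      have := (hg (-x)).comp x (hasDerivAt_neg x)
      simpa using! this
    have key := fwd (fun x p => -v (-x) p) (fun x p => -w (-x) p) (fun x => g (-x))
      (fun x => h (-x)) (fun x hx => by
        exact (hL (-x) (by rwa [abs_neg])).neg) (fun x hx p => by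
        have := hvw (-x) (by rwa [abs_neg]) p
        rw [← abs_neg] at this
        convert this using 2
        ring) (rev v g hg) (rev w h hh) (-x) (by linarith) hx
    simpa using key

theorem IsTameField.continuous_comp {v : ℝ → ℝ → ℝ} (hv : IsTameField v) {g : ℝ → ℝ}
    (hg : Continuous g) : Continuous fun x => v x (g x) := by
  rw [continuous_iff_continuousAt]
  intro x
  obtain ⟨L, B, -, hL⟩ := hv.tame (|x| + 1)
  have hb : Tendsto (fun y => L * |g y - g x| + |v y (g x) - v x (g x)|) (nhds x) (nhds 0) := by
    have h1 : Continuous fun y => L * |g y - g x| + |v y (g x) - v x (g x)| := by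
      have := hv.cont (g x)
      fun_prop
    have := h1.tendsto x
    simpa using this
  rw [ContinuousAt, tendsto_iff_dist_tendsto_zero]
  refine squeeze_zero' (Eventually.of_forall fun y => dist_nonneg) ?_ hb
  have hnear : ∀ᶠ y in nhds x, |y - x| < 1 := by
    have : Continuous fun y : ℝ => |y - x| := by fun_prop
    exact this.continuousAt.eventually_lt continuousAt_const (by simp)
  filter_upwards [hnear] with y hy
  have hyT : |y| ≤ |x| + 1 := by
    have := abs_sub_abs_le_abs_sub y x
    linarith
  have h2 := (hL y hyT).1.dist_le_mul (g y) (g x)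
  rw [Real.dist_eq, Real.dist_eq] at h2
  rw [Real.dist_eq]
  have h3 := abs_sub_le (v y (g y)) (v y (g x)) (v x (g x))
  linarith

/-- Explicit Euler scheme with step `h`. -/
noncomputable def eulerScheme (v : ℝ → ℝ → ℝ) (h c : ℝ) : ℕ → ℝ
  | 0 => c
  | k + 1 => eulerScheme v h c k + h * v (k * h) (eulerScheme v h c k)

theorem IsGlobalSol.euler_error {v : ℝ → ℝ → ℝ} {g : ℝ → ℝ}
    (hg : IsGlobalSol v g) {T η h : ℝ} {L : NNReal} {N : ℕ}
    (hL : ∀ x, |x| ≤ T → LipschitzWith L (v x)) (hN : N * |h| ≤ T)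
    (hη : ∀ x y, |x| ≤ T → |y| ≤ T → |x - y| ≤ |h| → |v x (g x) - v y (g y)| ≤ η) :
    ∀ k ≤ N, |eulerScheme v h (g 0) k - g (k * h)| ≤ k * (|h| * η) * (1 + |h| * L) ^ k := by
  intro k
  have hh := abs_nonneg h
  have hη0 : 0 ≤ η := by
    have hT : |(0 : ℝ)| ≤ T := by rw [abs_zero]; exact le_trans (by positivity) hN
    exact le_trans (abs_nonneg _) (hη 0 0 hT hT (by simp))
  induction k with
  | zero => intro _; simp [eulerScheme]
  | succ k ih =>
    intro hk
    have hmem : ∀ j : ℕ, j ≤ N → |(j : ℝ) * h| ≤ T := fun j hj => by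
      rw [abs_mul, Nat.abs_cast]
      refine le_trans ?_ hN
      have : (j : ℝ) ≤ N := by exact_mod_cast hj
      gcongr
    have ih := ih (by omega)
    have hkT := hmem k (by omega)
    have hkT1 := hmem (k + 1) hk
    have hloc : |g ((k + 1 : ℕ) * h) - g (k * h) - h * v (k * h) (g (k * h))| ≤ |h| * η := by
      have hd : ∀ x ∈ uIcc (k * h) ((k + 1 : ℕ) * h), HasDerivWithinAt
          (fun s => g s - s * v (k * h) (g (k * h))) (v x (g x) - v (k * h) (g (k * h)))
          (uIcc (k * h) ((k + 1 : ℕ) * h)) x := fun x _ => by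
        have := (hg x).sub ((hasDerivAt_id x).mul_const (v (k * h) (g (k * h))))
        simpa using! this.hasDerivWithinAt
      have hbd : ∀ x ∈ uIcc ((k : ℝ) * h) ((k + 1 : ℕ) * h),
          ‖v x (g x) - v (k * h) (g (k * h))‖ ≤ η := fun x hx => by
        have h1 : |x| ≤ T := by
          rw [mem_uIcc] at hx
          rw [abs_le] at hkT hkT1 ⊢
          rcases hx with hx | hx <;> constructor <;> linarith [hx.1, hx.2]
        have h2 := abs_sub_left_of_mem_uIcc hx
        refine hη x _ h1 hkT (le_trans h2 (le_of_eq ?_))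
        push_cast
        ring_nf
      have := (convex_uIcc _ _).norm_image_sub_le_of_norm_hasDerivWithin_le hd hbd
        left_mem_uIcc right_mem_uIcc
      rw [Real.norm_eq_abs, Real.norm_eq_abs] at this
      have e1 : |((k + 1 : ℕ) : ℝ) * h - k * h| = |h| := by push_cast; ring_nf
      rw [e1, mul_comm η |h|] at this
      convert this using 2
      push_cast
      ring
    have hLip := (hL _ hkT).dist_le_mul (eulerScheme v h (g 0) k) (g (k * h))
    rw [Real.dist_eq, Real.dist_eq] at hLip
    have hrec : eulerScheme v h (g 0) (k + 1) - g ((k + 1 : ℕ) * h) =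
        (eulerScheme v h (g 0) k - g (k * h))
          + h * (v (k * h) (eulerScheme v h (g 0) k) - v (k * h) (g (k * h)))
          - (g ((k + 1 : ℕ) * h) - g (k * h) - h * v (k * h) (g (k * h))) := by
      rw [eulerScheme]; ring
    set e := eulerScheme v h (g 0) k - g (k * h) with he
    have h4 : |eulerScheme v h (g 0) (k + 1) - g ((k + 1 : ℕ) * h)|
        ≤ |e| * (1 + |h| * L) + |h| * η := by
      rw [hrec]
      have a1 := abs_sub (e + h * (v (k * h) (eulerScheme v h (g 0) k) - v (k * h) (g (k * h))))
        (g ((k + 1 : ℕ) * h) - g (k * h) - h * v (k * h) (g (k * h)))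
      have a2 := abs_add_le e (h * (v (k * h) (eulerScheme v h (g 0) k) - v (k * h) (g (k * h))))
      rw [abs_mul] at a2
      have a3 := mul_le_mul_of_nonneg_left hLip hh
      nlinarith
    have hq : (1 : ℝ) ≤ 1 + |h| * L := by have : 0 ≤ |h| * L := by positivity
                                          linarith
    have hq1 : (1 : ℝ) ≤ (1 + |h| * L) ^ (k + 1) := one_le_pow₀ hq
    calc _ ≤ |e| * (1 + |h| * L) + |h| * η := h4
      _ ≤ (k * (|h| * η) * (1 + |h| * L) ^ k) * (1 + |h| * L)
          + |h| * η * (1 + |h| * L) ^ (k + 1) := by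
        have b1 := le_mul_of_one_le_right (by positivity : 0 ≤ |h| * η) hq1
        have b2 := mul_le_mul_of_nonneg_right ih (by positivity : 0 ≤ 1 + |h| * (L : ℝ))
        linarith
      _ = _ := by push_cast; ring

theorem IsGlobalSol.tendsto_euler {v : ℝ → ℝ → ℝ} (hv : IsTameField v) {g : ℝ → ℝ}
    (hg : IsGlobalSol v g) (x : ℝ) :
    Tendsto (fun n : ℕ => eulerScheme v (x / n) (g 0) n) atTop (nhds (g x)) := by
  obtain ⟨L, B, -, hL⟩ := hv.tame |x|
  have hcont := hv.continuous_comp hg.continuous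
  have huc := isCompact_Icc (a := -|x|) (b := |x|)
    |>.uniformContinuousOn_of_continuous hcont.continuousOn
  rw [Metric.uniformContinuousOn_iff_le] at huc
  rw [Metric.tendsto_atTop]
  intro ε hε
  have hD : 0 < (|x| + 1) * Real.exp (|x| * L) := by positivity
  obtain ⟨δ, hδ, hδ'⟩ := huc (ε / (2 * ((|x| + 1) * Real.exp (|x| * L)))) (by positivity)
  obtain ⟨N, hN⟩ := exists_nat_gt (|x| / δ)
  refine ⟨N + 1, fun n hn => ?_⟩
  have hn0 : (0 : ℝ) < n := by exact_mod_cast (by omega : 0 < n)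
  have hnN : (N : ℝ) ≤ n := by exact_mod_cast (by omega : N ≤ n)
  have habs : |x / n| = |x| / n := by rw [abs_div, Nat.abs_cast]
  have hstep : |x / n| ≤ δ := by
    rw [habs, div_le_iff₀ hn0]
    rw [div_lt_iff₀ hδ] at hN
    nlinarith
  have hnx : (n : ℝ) * |x / n| = |x| := by rw [habs]; field_simp
  have key := hg.euler_error (h := x / n) (fun y hy => (hL y hy).1) (N := n) hnx.le
    (η := ε / (2 * ((|x| + 1) * Real.exp (|x| * L))))
    (fun y z hy hz hyz => hδ' y (abs_le.1 hy) z (abs_le.1 hz) (by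
      rw [Real.dist_eq]; exact hyz.trans hstep)) n le_rfl
  have hnx' : (n : ℝ) * (x / n) = x := by field_simp
  rw [hnx'] at key
  rw [Real.dist_eq]
  refine lt_of_le_of_lt key ?_
  have hexp : (1 + |x / n| * L) ^ n ≤ Real.exp (|x| * L) := by
    have h1 : 1 + |x / n| * L ≤ Real.exp (|x / n| * L) := by
      rw [add_comm]; exact Real.add_one_le_exp _
    calc (1 + |x / n| * L) ^ n ≤ Real.exp (|x / n| * L) ^ n := by gcongr
      _ = Real.exp (|x| * L) := by rw [← Real.exp_nat_mul, ← mul_assoc, hnx]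
  have e1 : (n : ℝ) * (|x / n| * (ε / (2 * ((|x| + 1) * Real.exp (|x| * L))))) =
      |x| * (ε / (2 * ((|x| + 1) * Real.exp (|x| * L)))) := by rw [← mul_assoc, hnx]
  rw [e1]
  calc |x| * (ε / (2 * ((|x| + 1) * Real.exp (|x| * L)))) * (1 + |x / n| * L) ^ n
      ≤ (|x| + 1) * (ε / (2 * ((|x| + 1) * Real.exp (|x| * L)))) * Real.exp (|x| * L) := by
        gcongr; linarith
    _ = ε / 2 := by field_simp
    _ < ε := by linarith

/-- A measurable action of the real line. -/
structure IsAction {Ω : Type*} [MeasurableSpace Ω] (τ : ℝ → Ω → Ω) : Prop where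
  meas : Measurable fun q : ℝ × Ω => τ q.1 q.2
  zero : ∀ ω, τ 0 ω = ω
  add : ∀ x y ω, τ (x + y) ω = τ x (τ y ω)

/-- A family of monotone cocycles over an action, increasing in the level `l`. -/
structure IsFlow {Ω : Type*} [MeasurableSpace Ω] (τ : ℝ → Ω → Ω)
    (Φ : ℝ → ℝ → Ω → ℝ → ℝ) (C : ℝ) : Prop where
  zero : ∀ l ω c, Φ l 0 ω c = c
  add : ∀ l x y ω c, Φ l (x + y) ω c = Φ l x (τ y ω) (Φ l y ω c)
  mono : ∀ l x ω, Monotone (Φ l x ω)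
  lt_of_lt : ∀ l m x ω c, l < m → 0 < x → Φ l x ω c < Φ m x ω c
  cont : ∀ x ω, Continuous fun q : ℝ × ℝ => Φ q.1 x ω q.2
  cont_x : ∀ l ω c, Continuous fun x => Φ l x ω c
  meas : ∀ l x, Measurable fun q : Ω × ℝ => Φ l x q.1 q.2
  lt_up : ∀ l ω c, C < l → c < Φ l 1 ω c
  lt_down : ∀ l ω c, l < -C → Φ l 1 ω c < c

/-- Diffusivity `α` and Hamiltonian `η` seen from the origin of a stationary environment. -/
structure IsMedium {Ω : Type*} [MeasurableSpace Ω] (τ : ℝ → Ω → Ω) (α : Ω → ℝ) (η : ℝ → Ω → ℝ)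
    (K : NNReal) (C : ℝ) : Prop extends IsAction τ where
  alpha_meas : Measurable α
  alpha_pos : ∀ ω, 0 < α ω
  alpha_cont : ∀ ω, Continuous fun x => α (τ x ω)
  eta_meas : ∀ p, Measurable (η p)
  eta_lip : ∀ ω, LipschitzWith K fun p => η p ω
  eta_bdd : ∀ p ω, |η p ω| ≤ C
  eta_cont : ∀ p ω, Continuous fun x => η p (τ x ω)

/-- The vector field of the stationary equation with diffusivity `α`, Hamiltonian `η` and level `l`. -/
noncomputable def drift {Ω : Type*} (τ : ℝ → Ω → Ω) (α : Ω → ℝ) (η : ℝ → Ω → ℝ)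
    (l : ℝ) (ω : Ω) (x p : ℝ) : ℝ :=
  (l - η p (τ x ω)) / α (τ x ω)

section Medium

variable {Ω : Type*} [MeasurableSpace Ω] {τ : ℝ → Ω → Ω} {α : Ω → ℝ} {η : ℝ → Ω → ℝ}
  {K : NNReal} {C : ℝ}

theorem IsMedium.exists_alpha_lower (h : IsMedium τ α η K C) (ω : Ω) (T : ℝ) :
    ∃ a > 0, ∀ x, |x| ≤ T → a ≤ α (τ x ω) := by
  rcases lt_or_ge T 0 with hT | hT
  · exact ⟨1, one_pos, fun x hx => absurd (abs_nonneg x) (by linarith)⟩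
  obtain ⟨y, -, hy⟩ := (isCompact_Icc (a := -T) (b := T)).exists_isMinOn
    ⟨0, by constructor <;> linarith⟩ (h.alpha_cont ω).continuousOn
  exact ⟨_, h.alpha_pos (τ y ω), fun x hx => hy (abs_le.1 hx)⟩

theorem IsMedium.bound_nonneg (h : IsMedium τ α η K C) (ω : Ω) : 0 ≤ C :=
  (abs_nonneg _).trans (h.eta_bdd 0 ω)

theorem IsMedium.isTameField (h : IsMedium τ α η K C) (l : ℝ) (ω : Ω) :
    IsTameField (drift τ α η l ω) where
  cont p := (continuous_const.sub (h.eta_cont p ω)).div (h.alpha_cont ω)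
    fun x => (h.alpha_pos _).ne'
  tame T := by
    obtain ⟨a, ha, hle⟩ := h.exists_alpha_lower ω T
    have hC := h.bound_nonneg ω
    refine ⟨K * a⁻¹.toNNReal, (|l| + C) * a⁻¹, by positivity, fun x hx => ⟨?_, ?_⟩⟩
    · refine LipschitzWith.of_dist_le_mul fun p q => ?_
      have h1 := (h.eta_lip (τ x ω)).dist_le_mul p q
      have h2 : (α (τ x ω))⁻¹ ≤ a⁻¹ := inv_anti₀ ha (hle x hx)
      have h3 : 0 ≤ (α (τ x ω))⁻¹ := (inv_pos.2 (h.alpha_pos _)).le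
      rw [Real.dist_eq] at h1 ⊢
      have e : drift τ α η l ω x p - drift τ α η l ω x q =
          -((η p (τ x ω) - η q (τ x ω)) * (α (τ x ω))⁻¹) := by
        simp only [drift]; ring
      rw [e, abs_neg, abs_mul, abs_of_nonneg h3]
      push_cast
      calc _ ≤ (K * dist p q) * a⁻¹ := by gcongr
        _ = _ := by rw [Real.coe_toNNReal _ (by positivity)]; ring
    · intro p
      have h2 : (α (τ x ω))⁻¹ ≤ a⁻¹ := inv_anti₀ ha (hle x hx)
      have h3 : 0 ≤ (α (τ x ω))⁻¹ := (inv_pos.2 (h.alpha_pos _)).le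
      rw [drift, div_eq_mul_inv, abs_mul, abs_of_nonneg h3]
      have h4 : |l - η p (τ x ω)| ≤ |l| + C :=
        (abs_sub _ _).trans (by linarith [h.eta_bdd p (τ x ω)])
      gcongr

/-- The solution map of the stationary equation at level `l`. -/
noncomputable def IsMedium.flow (h : IsMedium τ α η K C) (l x : ℝ) (ω : Ω) (c : ℝ) : ℝ :=
  ((h.isTameField l ω).exists_global c).choose x

theorem IsMedium.flow_zero (h : IsMedium τ α η K C) (l : ℝ) (ω : Ω) (c : ℝ) :
    h.flow l 0 ω c = c :=
  ((h.isTameField l ω).exists_global c).choose_spec.1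

theorem IsMedium.flow_isGlobalSol (h : IsMedium τ α η K C) (l : ℝ) (ω : Ω) (c : ℝ) :
    IsGlobalSol (drift τ α η l ω) fun x => h.flow l x ω c :=
  ((h.isTameField l ω).exists_global c).choose_spec.2

theorem IsMedium.flow_add (h : IsMedium τ α η K C) (l x y : ℝ) (ω : Ω) (c : ℝ) :
    h.flow l (x + y) ω c = h.flow l x (τ y ω) (h.flow l y ω c) := by
  have h1 : IsGlobalSol (drift τ α η l (τ y ω)) fun x => h.flow l (x + y) ω c := fun x => by
    have := (h.flow_isGlobalSol l ω c (x + y)).comp x ((hasDerivAt_id x).add_const y)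
    simpa [drift, h.add, Function.comp_def] using! this
  exact congrFun (h1.eq_of_eq (h.isTameField l _) (h.flow_isGlobalSol l (τ y ω) _) (x₀ := 0)
    (by simp [h.flow_zero])) x

theorem IsMedium.drift_lt (h : IsMedium τ α η K C) {l m : ℝ} (hlm : l < m) (ω : Ω) (x p : ℝ) :
    drift τ α η l ω x p < drift τ α η m ω x p := by
  have := h.alpha_pos (τ x ω)
  unfold drift
  gcongr

theorem IsMedium.flow_lt (h : IsMedium τ α η K C) {l m x : ℝ} (hlm : l < m) (hx : 0 < x) (ω : Ω)
    {c d : ℝ} (hcd : c ≤ d) : h.flow l x ω c < h.flow m x ω d :=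
  (h.flow_isGlobalSol l ω c).lt_of_le_of_field_lt (h.drift_lt hlm ω) (h.flow_isGlobalSol m ω d)
    (x₀ := 0) (by simpa [h.flow_zero] using hcd) hx

theorem IsMedium.flow_dist_le (h : IsMedium τ α η K C) (ω : Ω) (x : ℝ) :
    ∃ (L : NNReal) (D : ℝ), ∀ l m c d,
      |h.flow l x ω c - h.flow m x ω d| ≤ gronwallBound |c - d| L (|m - l| * D) |x| := by
  obtain ⟨L, B, -, hL⟩ := (h.isTameField 0 ω).tame |x|
  obtain ⟨a, ha, hle⟩ := h.exists_alpha_lower ω |x|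
  refine ⟨L, a⁻¹, fun l m c d => ?_⟩
  have key := IsGlobalSol.dist_le (T := |x|) (L := L) (ε := |m - l| * a⁻¹)
    (v := drift τ α η l ω) (w := drift τ α η m ω) (fun y hy => ?_) (fun y hy p => ?_)
    (h.flow_isGlobalSol l ω c) (h.flow_isGlobalSol m ω d) le_rfl
  · simpa [h.flow_zero] using key
  · have e : drift τ α η l ω y = fun p => l / α (τ y ω) + drift τ α η 0 ω y p := by
      funext p; simp only [drift]; ring
    rw [e]
    refine LipschitzWith.of_dist_le_mul fun p q => ?_
    simpa [dist_add_left] using (hL y hy).1.dist_le_mul p q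
  · have e : drift τ α η m ω y p - drift τ α η l ω y p = (m - l) * (α (τ y ω))⁻¹ := by
      simp only [drift]; ring
    have h3 : 0 ≤ (α (τ y ω))⁻¹ := (inv_pos.2 (h.alpha_pos _)).le
    rw [e, abs_mul, abs_of_nonneg h3]
    gcongr
    exact hle y hy

theorem IsMedium.flow_continuous (h : IsMedium τ α η K C) (x : ℝ) (ω : Ω) :
    Continuous fun q : ℝ × ℝ => h.flow q.1 x ω q.2 := by
  obtain ⟨L, D, hLD⟩ := h.flow_dist_le ω x
  rw [continuous_iff_continuousAt]
  intro q
  rw [ContinuousAt, tendsto_iff_dist_tendsto_zero]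
  have hc : Continuous fun r : ℝ × ℝ => gronwallBound |r.2 - q.2| L (|q.1 - r.1| * D) |x| := by
    unfold gronwallBound
    split_ifs <;> fun_prop
  have h0 := hc.tendsto q
  have e : gronwallBound |q.2 - q.2| L (|q.1 - q.1| * D) |x| = 0 := by simp [gronwallBound]
  rw [e] at h0
  refine squeeze_zero (fun r => dist_nonneg) (fun r => ?_) h0
  rw [Real.dist_eq]
  exact hLD _ _ _ _

theorem IsMedium.flow_mono_of_nonneg (h : IsMedium τ α η K C) (l : ℝ) {x : ℝ} (hx : 0 ≤ x)
    (ω : Ω) : Monotone (h.flow l x ω) := by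
  intro c d hcd
  rcases hx.eq_or_lt with rfl | hx
  · simpa [h.flow_zero] using hcd
  have hc : Continuous fun m => h.flow m x ω d :=
    (h.flow_continuous x ω).comp (by fun_prop : Continuous fun m : ℝ => (m, d))
  have ht : Tendsto (fun m => h.flow m x ω d) (nhdsWithin l (Ioi l)) (nhds (h.flow l x ω d)) :=
    hc.continuousWithinAt
  refine ge_of_tendsto ht ?_
  filter_upwards [self_mem_nhdsWithin] with m hm
  exact (h.flow_lt hm hx ω hcd).le

theorem IsMedium.flow_mono (h : IsMedium τ α η K C) (l x : ℝ) (ω : Ω) :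
    Monotone (h.flow l x ω) := by
  rcases le_total 0 x with hx | hx
  · exact h.flow_mono_of_nonneg l hx ω
  have inv : ∀ c, h.flow l (-x) (τ x ω) (h.flow l x ω c) = c := fun c => by
    rw [← h.flow_add, neg_add_cancel, h.flow_zero]
  intro c d hcd
  by_contra hlt
  have := h.flow_mono_of_nonneg l (neg_nonneg.2 hx) (τ x ω) (not_le.1 hlt).le
  rw [inv, inv] at this
  exact hlt (le_of_eq (by rw [le_antisymm hcd this]))

theorem IsMedium.measurable_euler (h : IsMedium τ α η K C) (l s c : ℝ) (n : ℕ) :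
    Measurable fun ω => eulerScheme (drift τ α η l ω) s c n := by
  have hη : Measurable fun q : Ω × ℝ => η q.2 q.1 := by
    have := measurable_uncurry_of_continuous_of_measurable (u := fun p ω => η p ω)
      (fun ω => (h.eta_lip ω).continuous) h.eta_meas
    exact this.comp measurable_swap
  have hτ : ∀ x, Measurable (τ x) := fun x => h.meas.comp measurable_prodMk_left
  induction n with
  | zero => exact measurable_const
  | succ n ih =>
    have h1 : Measurable fun ω => η (eulerScheme (drift τ α η l ω) s c n) (τ (n * s) ω) :=
      hη.comp ((hτ _).prodMk ih)
    have h2 : Measurable fun ω => α (τ (n * s) ω) := h.alpha_meas.comp (hτ _)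
    simp only [eulerScheme]
    refine ih.add (measurable_const.mul ?_)
    exact (measurable_const.sub h1).div h2

theorem IsMedium.flow_measurable (h : IsMedium τ α η K C) (l x : ℝ) :
    Measurable fun q : Ω × ℝ => h.flow l x q.1 q.2 := by
  have h1 : ∀ c, Measurable fun ω => h.flow l x ω c := fun c => by
    refine measurable_of_tendsto_metrizable (fun n => h.measurable_euler l (x / n) c n)
      (tendsto_pi_nhds.2 fun ω => ?_)
    have := (h.flow_isGlobalSol l ω c).tendsto_euler (h.isTameField l ω) x
    simpa [h.flow_zero] using this
  have := measurable_uncurry_of_continuous_of_measurable (u := fun c ω => h.flow l x ω c)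
    (fun ω => (h.flow_continuous x ω).comp (by fun_prop : Continuous fun c : ℝ => (l, c))) h1
  exact this.comp measurable_swap

theorem IsMedium.isFlow (h : IsMedium τ α η K C) : IsFlow τ h.flow C where
  zero := h.flow_zero
  add := h.flow_add
  mono := h.flow_mono
  lt_of_lt l m x ω c hlm hx := h.flow_lt hlm hx ω le_rfl
  cont := h.flow_continuous
  cont_x l ω c := (h.flow_isGlobalSol l ω c).continuous
  meas := h.flow_measurable
  lt_up l ω c hl := by
    have hv : ∀ x p, (fun _ _ : ℝ => (0 : ℝ)) x p < drift τ α η l ω x p := fun x p =>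
      div_pos (by linarith [(abs_le.1 (h.eta_bdd p (τ x ω))).2]) (h.alpha_pos _)
    exact IsGlobalSol.lt_of_le_of_field_lt hv (g := fun _ => c) (x₀ := 0)
      (fun x => hasDerivAt_const x c) (h.flow_isGlobalSol l ω c) (by simp [h.flow_zero]) one_pos
  lt_down l ω c hl := by
    have hv : ∀ x p, drift τ α η l ω x p < (fun _ _ : ℝ => (0 : ℝ)) x p := fun x p =>
      div_neg_of_neg_of_pos (by linarith [(abs_le.1 (h.eta_bdd p (τ x ω))).1]) (h.alpha_pos _)
    exact IsGlobalSol.lt_of_le_of_field_lt hv (h := fun _ => c) (x₀ := 0)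
      (h.flow_isGlobalSol l ω c) (fun x => hasDerivAt_const x c) (by simp [h.flow_zero]) one_pos

end Medium

section Symmetry

variable {Ω : Type*} [MeasurableSpace Ω] {τ : ℝ → Ω → Ω} {Φ : ℝ → ℝ → Ω → ℝ → ℝ} {C : ℝ}

theorem IsAction.measurable (hτ : IsAction τ) (x : ℝ) : Measurable (τ x) :=
  hτ.meas.comp measurable_prodMk_left

theorem IsAction.reflect (hτ : IsAction τ) : IsAction fun x => τ (-x) where
  meas := hτ.meas.comp ((measurable_fst.neg).prodMk measurable_snd)
  zero ω := by simp [hτ.zero]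
  add x y ω := by rw [neg_add, hτ.add]

theorem IsFlow.inv (hΦ : IsFlow τ Φ C) (l x : ℝ) (ω : Ω) (c : ℝ) :
    Φ l (-x) (τ x ω) (Φ l x ω c) = c := by
  rw [← hΦ.add, neg_add_cancel, hΦ.zero]

theorem IsFlow.lt_of_lt_neg (hΦ : IsFlow τ Φ C) {l m x : ℝ} (hlm : l < m) (hx : 0 < x)
    (ω : Ω) (c : ℝ) : Φ m (-x) ω c < Φ l (-x) ω c := by
  by_contra hle
  have h1 := hΦ.mono l x (τ (-x) ω) (not_lt.1 hle)
  have h2 := hΦ.lt_of_lt l m x (τ (-x) ω) (Φ m (-x) ω c) hlm hx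
  rw [← hΦ.add, add_neg_cancel, hΦ.zero] at h1 h2
  linarith

theorem IsFlow.reflect (hΦ : IsFlow τ Φ C) :
    IsFlow (fun x => τ (-x)) (fun l x ω c => -Φ l (-x) ω (-c)) C where
  zero l ω c := by simp [hΦ.zero]
  add l x y ω c := by rw [neg_add, hΦ.add, neg_neg]
  mono l x ω c d hcd := neg_le_neg (hΦ.mono l _ ω (neg_le_neg hcd))
  lt_of_lt l m x ω c hlm hx := neg_lt_neg (hΦ.lt_of_lt_neg hlm hx ω _)
  cont x ω := ((hΦ.cont (-x) ω).comp
    (by fun_prop : Continuous fun q : ℝ × ℝ => (q.1, -q.2))).neg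
  cont_x l ω c := ((hΦ.cont_x l ω (-c)).comp continuous_neg).neg
  meas l x := ((hΦ.meas l (-x)).comp (measurable_fst.prodMk measurable_snd.neg)).neg
  lt_up l ω c hl := by
    have := hΦ.lt_up l (τ (-1) ω) (Φ l (-1) ω (-c)) hl
    rw [← hΦ.add, add_neg_cancel, hΦ.zero] at this
    linarith
  lt_down l ω c hl := by
    have := hΦ.lt_down l (τ (-1) ω) (Φ l (-1) ω (-c)) hl
    rw [← hΦ.add, add_neg_cancel, hΦ.zero] at this
    linarith

theorem IsFlow.neg (hΦ : IsFlow τ Φ C) : IsFlow τ (fun l x ω c => -Φ (-l) x ω (-c)) C where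
  zero l ω c := by simp [hΦ.zero]
  add l x y ω c := by rw [hΦ.add, neg_neg]
  mono l x ω c d hcd := neg_le_neg (hΦ.mono _ _ ω (neg_le_neg hcd))
  lt_of_lt l m x ω c hlm hx := neg_lt_neg (hΦ.lt_of_lt _ _ x ω _ (neg_lt_neg hlm) hx)
  cont x ω := ((hΦ.cont x ω).comp
    (by fun_prop : Continuous fun q : ℝ × ℝ => (-q.1, -q.2))).neg
  cont_x l ω c := (hΦ.cont_x (-l) ω (-c)).neg
  meas l x := ((hΦ.meas (-l) x).comp (measurable_fst.prodMk measurable_snd.neg)).neg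
  lt_up l ω c hl := by
    have := hΦ.lt_down (-l) ω (-c) (by linarith)
    linarith
  lt_down l ω c hl := by
    have := hΦ.lt_up (-l) ω (-c) (by linarith)
    linarith

theorem IsFlow.continuous_right (hΦ : IsFlow τ Φ C) (l x : ℝ) (ω : Ω) : Continuous (Φ l x ω) :=
  (hΦ.cont x ω).comp (by fun_prop : Continuous fun c : ℝ => (l, c))

theorem IsFlow.measurable_joint (hΦ : IsFlow τ Φ C) (l : ℝ) :
    Measurable fun q : ℝ × Ω × ℝ => Φ l q.1 q.2.1 q.2.2 :=
  measurable_uncurry_of_continuous_of_measurable (u := fun (x : ℝ) (q : Ω × ℝ) => Φ l x q.1 q.2)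
    (fun q => hΦ.cont_x l q.1 q.2) (hΦ.meas l)

end Symmetry

/-- Garsia's functional: the running maximum of the Birkhoff sums of `Y`, truncated at `0`. -/
noncomputable def garsiaMax {Ω : Type*} (T : Ω → Ω) (Y : Ω → ℝ) : ℕ → Ω → ℝ
  | 0 => fun _ => 0
  | n + 1 => fun ω => max 0 (Y ω + garsiaMax T Y n (T ω))

section Garsia

variable {Ω : Type*} {T : Ω → Ω} {Y : Ω → ℝ} {B : ℝ}

theorem garsiaMax_nonneg (T : Ω → Ω) (Y : Ω → ℝ) (n : ℕ) (ω : Ω) : 0 ≤ garsiaMax T Y n ω := by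
  cases n with
  | zero => exact le_rfl
  | succ n => exact le_max_left _ _

theorem garsiaMax_le_succ (T : Ω → Ω) (Y : Ω → ℝ) (n : ℕ) (ω : Ω) :
    garsiaMax T Y n ω ≤ garsiaMax T Y (n + 1) ω := by
  induction n generalizing ω with
  | zero => exact garsiaMax_nonneg T Y 1 ω
  | succ n ih => exact max_le_max le_rfl (by linarith [ih (T ω)])

theorem garsiaMax_le (hB : ∀ ω, |Y ω| ≤ B) (hB0 : 0 ≤ B) (n : ℕ) (ω : Ω) :
    garsiaMax T Y n ω ≤ n * B := by
  induction n generalizing ω with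
  | zero => simp [garsiaMax]
  | succ n ih =>
    refine max_le (by positivity) ?_
    have := ih (T ω)
    have := (abs_le.1 (hB ω)).2
    push_cast
    linarith

variable [MeasurableSpace Ω] {P : Measure Ω}

theorem garsiaMax_measurable (hT : Measurable T) (hY : Measurable Y) (n : ℕ) :
    Measurable (garsiaMax T Y n) := by
  induction n with
  | zero => exact measurable_const
  | succ n ih => exact measurable_const.max (hY.add (ih.comp hT))

theorem setIntegral_garsiaMax_pos_nonneg [IsProbabilityMeasure P] (hT : MeasurePreserving T P P)
    (hY : Measurable Y) (hB : ∀ ω, |Y ω| ≤ B) (n : ℕ) :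
    0 ≤ ∫ ω in {ω | 0 < garsiaMax T Y n ω}, Y ω ∂P := by
  have hB0 : 0 ≤ B := by
    obtain ⟨ω⟩ := nonempty_of_isProbabilityMeasure P
    exact (abs_nonneg _).trans (hB ω)
  set G := garsiaMax T Y n with hG
  have hGm : Measurable G := garsiaMax_measurable hT.measurable hY n
  have hint : ∀ {f : Ω → ℝ} (D : ℝ), Measurable f → (∀ ω, |f ω| ≤ D) → Integrable f P :=
    fun D hf hD => Integrable.of_bound hf.aestronglyMeasurable D (Eventually.of_forall hD)
  have hGb : ∀ ω, |G ω| ≤ n * B := fun ω => by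
    rw [abs_of_nonneg (garsiaMax_nonneg _ _ _ _)]
    exact garsiaMax_le hB hB0 n ω
  have hGi : Integrable G P := hint _ hGm hGb
  have hGTi : Integrable (fun ω => G (T ω)) P :=
    hint _ (hGm.comp hT.measurable) (fun ω => hGb _)
  have hS : MeasurableSet {ω | 0 < G ω} := measurableSet_lt measurable_const hGm
  have hYi : Integrable Y P := hint B hY hB
  rw [← integral_indicator hS]
  have h1 : ∀ ω, G ω - G (T ω) ≤ {ω | 0 < G ω}.indicator Y ω := by
    intro ω
    by_cases hω : 0 < G ω
    · rw [indicator_of_mem (by exact hω)]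
      cases n with
      | zero => exact absurd hω (lt_irrefl _)
      | succ n =>
        have h2 : G ω = max 0 (Y ω + garsiaMax T Y n (T ω)) := rfl
        have h3 : G ω = Y ω + garsiaMax T Y n (T ω) := by
          rw [h2] at hω ⊢
          rcases le_total (Y ω + garsiaMax T Y n (T ω)) 0 with h | h
          · rw [max_eq_left h] at hω; exact absurd hω (lt_irrefl _)
          · exact max_eq_right h
        have := garsiaMax_le_succ T Y n (T ω)
        rw [hG] at h3 ⊢
        linarith
    · rw [indicator_of_notMem (by exact hω)]
      have := garsiaMax_nonneg T Y n (T ω)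
      linarith [not_lt.1 hω]
  have h2 : ∫ ω, (G ω - G (T ω)) ∂P = 0 := by
    rw [integral_sub hGi hGTi]
    have : ∫ ω, G (T ω) ∂P = ∫ ω, G ω ∂P := by
      have := integral_map (μ := P) hT.measurable.aemeasurable (f := G)
        hGm.aestronglyMeasurable
      rw [hT.map_eq] at this
      exact this.symm
    rw [this, sub_self]
  have h3 := integral_mono (hGi.sub hGTi) (hYi.indicator hS) h1
  exact h2.symm.le.trans h3

/-- Maximal ergodic inequality. -/
theorem integral_nonneg_of_ae_exists_garsiaMax_pos [IsProbabilityMeasure P]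
    (hT : MeasurePreserving T P P) (hY : Measurable Y) (hB : ∀ ω, |Y ω| ≤ B)
    (hpos : ∀ᵐ ω ∂P, ∃ n, 0 < garsiaMax T Y n ω) : 0 ≤ ∫ ω, Y ω ∂P := by
  have hS : ∀ n, MeasurableSet {ω | 0 < garsiaMax T Y n ω} := fun n =>
    measurableSet_lt measurable_const (garsiaMax_measurable hT.measurable hY n)
  have hlim : Tendsto (fun n => ∫ ω, {ω | 0 < garsiaMax T Y n ω}.indicator Y ω ∂P) atTop
      (nhds (∫ ω, Y ω ∂P)) := by
    refine tendsto_integral_of_dominated_convergence (fun _ => B)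
      (fun n => (hY.indicator (hS n)).aestronglyMeasurable) (integrable_const B)
      (fun n => Eventually.of_forall fun ω => ?_) ?_
    · exact (norm_indicator_le_norm_self _ _).trans (hB ω)
    · filter_upwards [hpos] with ω ⟨n, hn⟩
      refine tendsto_const_nhds.congr' ?_
      filter_upwards [eventually_ge_atTop n] with m hm
      rw [indicator_of_mem]
      exact lt_of_lt_of_le hn (monotone_nat_of_le_succ (fun k => garsiaMax_le_succ T Y k ω) hm)
  refine ge_of_tendsto' hlim fun n => ?_
  rw [integral_indicator (hS n)]
  exact setIntegral_garsiaMax_pos_nonneg hT hY hB n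

end Garsia

/-- An ergodic measure preserving action of the real line. -/
structure IsErgodicAction {Ω : Type*} [MeasurableSpace Ω] (P : Measure Ω)
    (τ : ℝ → Ω → Ω) : Prop extends IsAction τ where
  mp : ∀ x, MeasurePreserving (τ x) P P
  ergodic : ∀ A : Set Ω, MeasurableSet A → (∀ x, τ x ⁻¹' A = A) → P A = 0 ∨ P A = 1

section ErgodicTheorem

variable {Ω : Type*} {τ : ℝ → Ω → Ω} {X : Ω → ℝ} {B : ℝ}

theorem abs_integral_comp_le (hB : ∀ ω, |X ω| ≤ B) (ω : Ω) (x y : ℝ) :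
    |∫ s in x..y, X (τ s ω)| ≤ B * |y - x| := by
  rw [← Real.norm_eq_abs]
  exact intervalIntegral.norm_integral_le_of_norm_le_const fun s _ => hB _

variable [MeasurableSpace Ω] {P : Measure Ω}

theorem IsErgodicAction.reflect (hτ : IsErgodicAction P τ) :
    IsErgodicAction P fun x => τ (-x) where
  toIsAction := hτ.toIsAction.reflect
  mp x := hτ.mp (-x)
  ergodic A hA hinv := hτ.ergodic A hA fun x => by simpa using hinv (-x)

theorem IsAction.measurable_path (hτ : IsAction τ) (hX : Measurable X) (ω : Ω) :
    Measurable fun s => X (τ s ω) :=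
  hX.comp (hτ.meas.comp measurable_prodMk_right)

theorem IsAction.intervalIntegrable (hτ : IsAction τ) (hX : Measurable X) (hB : ∀ ω, |X ω| ≤ B)
    (ω : Ω) (x y : ℝ) : IntervalIntegrable (fun s => X (τ s ω)) volume x y := by
  refine (intervalIntegrable_const (c := B)).mono_fun
    (hτ.measurable_path hX ω).aestronglyMeasurable (Eventually.of_forall fun s => ?_)
  exact (hB _).trans (le_abs_self B)

theorem IsAction.integral_shift (hτ : IsAction τ) (hX : Measurable X) (hB : ∀ ω, |X ω| ≤ B)
    (ω : Ω) (x y : ℝ) :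
    ∫ s in 0..y, X (τ s (τ x ω)) = (∫ s in 0..(x + y), X (τ s ω)) - ∫ s in 0..x, X (τ s ω) := by
  have h1 : ∫ s in 0..y, X (τ s (τ x ω)) = ∫ s in x..(x + y), X (τ s ω) := by
    simp_rw [← hτ.add]
    rw [intervalIntegral.integral_comp_add_right (fun s => X (τ s ω)), zero_add, add_comm y x]
  rw [h1, intervalIntegral.integral_interval_sub_left (hτ.intervalIntegrable hX hB ω _ _)
    (hτ.intervalIntegrable hX hB ω _ _)]

theorem IsAction.measurable_integral (hτ : IsAction τ) (hX : Measurable X) (x : ℝ) :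
    Measurable fun ω => ∫ s in 0..x, X (τ s ω) := by
  have h1 : StronglyMeasurable fun q : Ω × ℝ => X (τ q.2 q.1) :=
    (hX.comp (hτ.meas.comp measurable_swap)).stronglyMeasurable
  simp only [intervalIntegral]
  exact (h1.integral_prod_right').measurable.sub (h1.integral_prod_right').measurable

theorem IsErgodicAction.integral_comp (hτ : IsErgodicAction P τ) (hX : Measurable X) (x : ℝ) :
    ∫ ω, X (τ x ω) ∂P = ∫ ω, X ω ∂P := by
  have := integral_map (μ := P) (hτ.mp x).measurable.aemeasurable (f := X) hX.aestronglyMeasurable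
  rw [(hτ.mp x).map_eq] at this
  exact this.symm

theorem IsErgodicAction.integral_integral [IsProbabilityMeasure P] (hτ : IsErgodicAction P τ)
    (hX : Measurable X) (hB : ∀ ω, |X ω| ≤ B) :
    ∫ ω, (∫ s in (0 : ℝ)..1, X (τ s ω)) ∂P = ∫ ω, X ω ∂P := by
  simp only [intervalIntegral.integral_of_le zero_le_one]
  rw [integral_integral_swap]
  · simp [hτ.integral_comp hX]
  · refine Integrable.of_bound (C := B) ?_ (Eventually.of_forall fun q => hB _)
    exact (hX.comp (hτ.meas.comp measurable_swap)).aestronglyMeasurable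

theorem IsErgodicAction.ae_le_nat [IsProbabilityMeasure P] (hτ : IsErgodicAction P τ)
    (hX : Measurable X) (hB : ∀ ω, |X ω| ≤ B) {c : ℝ} (hc : ∫ ω, X ω ∂P < c) :
    ∀ᵐ ω ∂P, ∃ D : ℕ, ∀ n : ℕ, ∫ s in 0..(n : ℝ), X (τ s ω) ≤ c * n + D := by
  set F : Ω → ℝ → ℝ := fun ω x => ∫ s in 0..x, X (τ s ω) with hF
  set A : Set Ω := {ω | ∀ D : ℕ, ∃ n : ℕ, c * n + D < F ω n} with hA
  have hAm : MeasurableSet A := by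
    have : A = ⋂ D : ℕ, ⋃ n : ℕ, {ω | c * n + D < F ω n} := by
      ext ω; simp [hA]
    rw [this]
    exact MeasurableSet.iInter fun D => MeasurableSet.iUnion fun n =>
      measurableSet_lt measurable_const (hτ.measurable_integral hX n)
  have hB0 : 0 ≤ B := by
    obtain ⟨ω⟩ := nonempty_of_isProbabilityMeasure P
    exact (abs_nonneg _).trans (hB ω)
  have hsub : ∀ x ω, ω ∈ A → τ x ω ∈ A := by
    intro x ω hω D
    obtain ⟨n, hn⟩ := hω (D + ⌈2 * (B * |x|)⌉₊)
    refine ⟨n, ?_⟩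
    have h1 := hτ.integral_shift hX hB ω x n
    have h2 : F ω (x + n) = F ω n + ∫ s in (n : ℝ)..(x + n), X (τ s ω) :=
      (intervalIntegral.integral_add_adjacent_intervals (hτ.intervalIntegrable hX hB ω _ _)
        (hτ.intervalIntegrable hX hB ω _ _)).symm
    have h3 := (abs_le.1 (abs_integral_comp_le (τ := τ) hB ω n (x + n))).1
    have h4 := (abs_le.1 (abs_integral_comp_le (τ := τ) hB ω 0 x)).2
    have h5 := Nat.le_ceil (2 * (B * |x|))
    push_cast at hn
    simp only [hF] at *
    rw [h1, h2]
    simp only [add_sub_cancel_right, sub_zero] at h3 h4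
    linarith
  have hinv : ∀ x, τ x ⁻¹' A = A := by
    intro x
    ext ω
    refine ⟨fun h => ?_, fun h => hsub x ω h⟩
    have := hsub (-x) _ h
    rwa [← hτ.add, neg_add_cancel, hτ.zero] at this
  rcases hτ.ergodic A hAm hinv with h0 | h1
  · have : ∀ᵐ ω ∂P, ω ∉ A := measure_eq_zero_iff_ae_notMem.1 h0
    filter_upwards [this] with ω hω
    simpa [hA] using hω
  · exfalso
    have hAe : ∀ᵐ ω ∂P, ω ∈ A := (prob_compl_eq_zero_iff hAm).2 h1
    set Y : Ω → ℝ := fun ω => F ω 1 - c with hY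
    have hYm : Measurable Y := (hτ.measurable_integral hX 1).sub_const c
    have hFb : ∀ ω, |F ω 1| ≤ B := fun ω => by
      have := abs_integral_comp_le (τ := τ) hB ω 0 1
      simpa using this
    have hYb : ∀ ω, |Y ω| ≤ B + |c| := fun ω =>
      (abs_sub _ _).trans <| add_le_add (hFb ω) le_rfl
    have hge : ∀ (n : ℕ) ω, F ω n - c * n ≤ garsiaMax (τ 1) Y n ω := by
      intro n
      induction n with
      | zero => intro ω; simp [hF, garsiaMax]
      | succ n ih =>
        intro ω
        refine le_trans ?_ (le_max_right _ _)
        have := ih (τ 1 ω)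
        have h1 := hτ.integral_shift hX hB ω 1 n
        simp only [hF, hY] at *
        rw [h1] at this
        push_cast
        rw [add_comm (n : ℝ) 1]
        linarith
    have hpos : 0 ≤ ∫ ω, Y ω ∂P := by
      refine integral_nonneg_of_ae_exists_garsiaMax_pos (hτ.mp 1) hYm hYb ?_
      filter_upwards [hAe] with ω hω
      obtain ⟨n, hn⟩ := hω 0
      exact ⟨n, lt_of_lt_of_le (by push_cast at hn; linarith) (hge n ω)⟩
    have hFi : Integrable (fun ω => F ω 1) P :=
      Integrable.of_bound (hτ.measurable_integral hX 1).aestronglyMeasurable B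
        (Eventually.of_forall hFb)
    rw [hY, integral_sub hFi (integrable_const c), hτ.integral_integral hX hB] at hpos
    simp at hpos
    linarith

theorem IsErgodicAction.ae_le_of_nonneg [IsProbabilityMeasure P] (hτ : IsErgodicAction P τ)
    (hX : Measurable X) (hB : ∀ ω, |X ω| ≤ B) :
    ∀ᵐ ω ∂P, ∀ κ > 0, ∃ D, ∀ x ≥ 0,
      ∫ s in 0..x, X (τ s ω) ≤ x * (∫ ω, X ω ∂P) + κ * x + D := by
  set m := ∫ ω, X ω ∂P with hm
  have h : ∀ᵐ ω ∂P, ∀ k : ℕ, ∃ D : ℕ, ∀ n : ℕ,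
      ∫ s in 0..(n : ℝ), X (τ s ω) ≤ (m + 1 / ((k : ℝ) + 1)) * n + D :=
    ae_all_iff.2 fun k => hτ.ae_le_nat hX hB (by
      have : 0 < 1 / ((k : ℝ) + 1) := by positivity
      linarith)
  filter_upwards [h] with ω hω κ hκ
  obtain ⟨k, hk⟩ := exists_nat_one_div_lt hκ
  obtain ⟨D, hD⟩ := hω k
  refine ⟨D + B + |m|, fun x hx => ?_⟩
  have h1 := hD ⌊x⌋₊
  have h2 : ∫ s in 0..x, X (τ s ω) = (∫ s in 0..(⌊x⌋₊ : ℝ), X (τ s ω))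
      + ∫ s in (⌊x⌋₊ : ℝ)..x, X (τ s ω) :=
    (intervalIntegral.integral_add_adjacent_intervals (hτ.intervalIntegrable hX hB ω _ _)
      (hτ.intervalIntegrable hX hB ω _ _)).symm
  have h3 := (abs_le.1 (abs_integral_comp_le (τ := τ) hB ω ⌊x⌋₊ x)).2
  have h4 := Nat.floor_le hx
  have h5 := Nat.lt_floor_add_one x
  have hB0 : 0 ≤ B := (abs_nonneg _).trans (hB ω)
  rw [abs_of_nonneg (by linarith)] at h3
  have h6 : B * (x - ⌊x⌋₊) ≤ B := by nlinarith
  have h7 : m * ⌊x⌋₊ ≤ x * m + |m| := by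
    have : m * ⌊x⌋₊ - x * m = (-m) * (x - ⌊x⌋₊) := by ring
    have h8 : (-m) * (x - ⌊x⌋₊) ≤ |m| * 1 :=
      mul_le_mul (neg_le_abs m) (by linarith) (by linarith) (abs_nonneg m)
    linarith
  have h9 : 1 / ((k : ℝ) + 1) * ⌊x⌋₊ ≤ κ * x :=
    mul_le_mul hk.le h4 (by positivity) hκ.le
  rw [h2]
  linarith

theorem IsErgodicAction.ae_abs_le_of_nonneg [IsProbabilityMeasure P] (hτ : IsErgodicAction P τ)
    (hX : Measurable X) (hB : ∀ ω, |X ω| ≤ B) :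
    ∀ᵐ ω ∂P, ∀ κ > 0, ∃ D, ∀ x ≥ 0,
      |(∫ s in 0..x, X (τ s ω)) - x * (∫ ω, X ω ∂P)| ≤ κ * x + D := by
  have h2 := hτ.ae_le_of_nonneg (X := fun ω => -X ω) (B := B) hX.neg (fun ω => by simpa using hB ω)
  filter_upwards [hτ.ae_le_of_nonneg hX hB, h2] with ω h1 h2 κ hκ
  obtain ⟨D1, hD1⟩ := h1 κ hκ
  obtain ⟨D2, hD2⟩ := h2 κ hκ
  refine ⟨max D1 D2, fun x hx => ?_⟩
  have a1 := hD1 x hx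
  have a2 := hD2 x hx
  simp only [intervalIntegral.integral_neg, integral_neg] at a2
  have := le_max_left D1 D2
  have := le_max_right D1 D2
  rw [abs_le]
  constructor <;> linarith

/-- The ergodic theorem for bounded observables of an ergodic action of the real line. -/
theorem IsErgodicAction.ae_abs_integral_sub_le [IsProbabilityMeasure P]
    (hτ : IsErgodicAction P τ) (hX : Measurable X) (hB : ∀ ω, |X ω| ≤ B) :
    ∀ᵐ ω ∂P, ∀ κ > 0, ∃ D, ∀ x,
      |(∫ s in 0..x, X (τ s ω)) - x * (∫ ω, X ω ∂P)| ≤ κ * |x| + D := by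
  filter_upwards [hτ.ae_abs_le_of_nonneg hX hB, hτ.reflect.ae_abs_le_of_nonneg hX hB]
    with ω h1 h2 κ hκ
  obtain ⟨D1, hD1⟩ := h1 κ hκ
  obtain ⟨D2, hD2⟩ := h2 κ hκ
  refine ⟨max D1 D2, fun x => ?_⟩
  rcases le_total 0 x with hx | hx
  · rw [abs_of_nonneg hx]
    exact (hD1 x hx).trans (by linarith [le_max_left D1 D2])
  · rw [abs_of_nonpos hx]
    have := hD2 (-x) (by linarith)
    rw [intervalIntegral.integral_comp_neg (fun s => X (τ s ω)), intervalIntegral.integral_symm,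
      ← abs_neg] at this
    simp only [neg_neg, neg_zero] at this
    refine le_trans (le_of_eq ?_) (this.trans (by linarith [le_max_right D1 D2]))
    congr 1
    ring

/-- A measurable set that is invariant up to null sets is trivial. -/
theorem IsErgodicAction.ae_mem_or_ae_notMem [IsProbabilityMeasure P] (hτ : IsErgodicAction P τ)
    {A : Set Ω} (hA : MeasurableSet A) (hinv : ∀ x, ∀ᵐ ω ∂P, τ x ω ∈ A ↔ ω ∈ A) :
    (∀ᵐ ω ∂P, ω ∈ A) ∨ ∀ᵐ ω ∂P, ω ∉ A := by
  set X : Ω → ℝ := A.indicator 1 with hX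
  have hXm : Measurable X := measurable_one.indicator hA
  have hXb : ∀ ω, |X ω| ≤ 1 := fun ω => by
    by_cases h : ω ∈ A <;> simp [hX, h]
  have hms : MeasurableSet {q : Ω × ℝ | τ q.2 q.1 ∈ A ↔ q.1 ∈ A} := by
    have m1 : MeasurableSet {q : Ω × ℝ | τ q.2 q.1 ∈ A} := (hτ.meas.comp measurable_swap) hA
    have m2 : MeasurableSet {q : Ω × ℝ | q.1 ∈ A} := measurable_fst hA
    exact m1.iff m2
  have hae : ∀ᵐ ω ∂P, ∀ᵐ s : ℝ, τ s ω ∈ A ↔ ω ∈ A := by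
    rw [← Measure.ae_prod_iff_ae_ae hms]
    have : ∀ᵐ q : ℝ × Ω ∂(volume.prod P), τ q.1 q.2 ∈ A ↔ q.2 ∈ A := by
      refine (Measure.ae_prod_iff_ae_ae (p := fun q : ℝ × Ω => τ q.1 q.2 ∈ A ↔ q.2 ∈ A)
        (measurable_swap hms)).2 ?_
      exact Eventually.of_forall hinv
    rw [← Measure.prod_swap, ae_map_iff measurable_swap.aemeasurable hms]
    exact this
  have hconst : ∀ᵐ ω ∂P, X ω = ∫ ω, X ω ∂P := by
    filter_upwards [hae, hτ.ae_abs_integral_sub_le hXm hXb] with ω h1 h2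
    have e : ∀ x, ∫ s in 0..x, X (τ s ω) = x * X ω := fun x => by
      have : ∫ s in 0..x, X (τ s ω) = ∫ s in 0..x, X ω := by
        refine intervalIntegral.integral_congr_ae ?_
        filter_upwards [h1] with s hs _
        by_cases h : ω ∈ A
        · simp [hX, h, hs.2 h]
        · simp [hX, h, mt hs.1 h]
      rw [this]; simp
    by_contra hne
    set d := |X ω - ∫ ω, X ω ∂P| with hd
    have hd0 : 0 < d := abs_pos.2 (sub_ne_zero.2 hne)
    obtain ⟨D, hD⟩ := h2 (d / 2) (by positivity)
    have hD0 : 0 ≤ D := by simpa using hD 0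
    have := hD ((2 * D + 2) / d)
    have hp : 0 ≤ (2 * D + 2) / d := by positivity
    rw [e, ← mul_sub, abs_mul, abs_of_nonneg hp, ← hd] at this
    have e2 : (2 * D + 2) / d * d = 2 * D + 2 := by field_simp
    have e3 : d / 2 * ((2 * D + 2) / d) = D + 1 := by field_simp
    linarith
  by_cases h0 : ∫ ω, X ω ∂P = 0
  · right
    filter_upwards [hconst] with ω hω hmem
    rw [h0] at hω
    simp [hX, hmem] at hω
  · left
    filter_upwards [hconst] with ω hω
    by_contra hmem
    apply h0
    rw [← hω]
    simp [hX, hmem]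

end ErgodicTheorem

/-- `f` generates a stationary solution with values in `[-R, R]` at level `l`. -/
structure IsStat {Ω : Type*} [MeasurableSpace Ω] (P : Measure Ω) (τ : ℝ → Ω → Ω)
    (Φ : ℝ → ℝ → Ω → ℝ → ℝ) (R l : ℝ) (f : Ω → ℝ) : Prop where
  meas : Measurable f
  bdd : ∀ ω, |f ω| ≤ R
  inv : ∀ x, ∀ᵐ ω ∂P, f (τ x ω) = Φ l x ω (f ω)

/-- Two stationary solutions at the same level with no stationary solution of intermediate mean. -/
structure IsGap {Ω : Type*} [MeasurableSpace Ω] (P : Measure Ω) (τ : ℝ → Ω → Ω)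
    (Φ : ℝ → ℝ → Ω → ℝ → ℝ) (R l : ℝ) (f₁ f₂ : Ω → ℝ) : Prop where
  left : IsStat P τ Φ R l f₁
  right : IsStat P τ Φ R l f₂
  lt : ∫ ω, f₁ ω ∂P < ∫ ω, f₂ ω ∂P
  gap : ∀ m g, IsStat P τ Φ R m g → ∫ ω, g ω ∂P ≤ ∫ ω, f₁ ω ∂P ∨ ∫ ω, f₂ ω ∂P ≤ ∫ ω, g ω ∂P

section Stat

variable {Ω : Type*} [MeasurableSpace Ω] {P : Measure Ω} {τ : ℝ → Ω → Ω}
  {Φ : ℝ → ℝ → Ω → ℝ → ℝ} {C R l m : ℝ} {f g : Ω → ℝ}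

theorem IsStat.neg (hf : IsStat P τ Φ R l f) :
    IsStat P τ (fun l x ω c => -Φ (-l) x ω (-c)) R (-l) (fun ω => -f ω) where
  meas := hf.meas.neg
  bdd ω := by simpa using hf.bdd ω
  inv x := by filter_upwards [hf.inv x] with ω hω; simp [hω]

theorem IsStat.of_neg (hf : IsStat P τ (fun l x ω c => -Φ (-l) x ω (-c)) R l f) :
    IsStat P τ Φ R (-l) (fun ω => -f ω) where
  meas := hf.meas.neg
  bdd ω := by simpa using hf.bdd ω
  inv x := by filter_upwards [hf.inv x] with ω hω; simp [hω]

theorem IsStat.reflect (hf : IsStat P τ Φ R l f) :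
    IsStat P (fun x => τ (-x)) (fun l x ω c => -Φ l (-x) ω (-c)) R l (fun ω => -f ω) where
  meas := hf.meas.neg
  bdd ω := by simpa using hf.bdd ω
  inv x := by filter_upwards [hf.inv (-x)] with ω hω; simp [hω]

theorem IsStat.of_reflect
    (hf : IsStat P (fun x => τ (-x)) (fun l x ω c => -Φ l (-x) ω (-c)) R l f) :
    IsStat P τ Φ R l (fun ω => -f ω) where
  meas := hf.meas.neg
  bdd ω := by simpa using hf.bdd ω
  inv x := by
    filter_upwards [hf.inv (-x)] with ω hω
    rw [neg_neg] at hω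
    rw [hω, neg_neg]

theorem IsGap.neg {f₁ f₂ : Ω → ℝ} (h : IsGap P τ Φ R l f₁ f₂) :
    IsGap P τ (fun l x ω c => -Φ (-l) x ω (-c)) R (-l) (fun ω => -f₂ ω) (fun ω => -f₁ ω) where
  left := h.right.neg
  right := h.left.neg
  lt := by simpa only [integral_neg, neg_lt_neg_iff] using h.lt
  gap m g hg := by
    have := h.gap _ _ hg.of_neg
    simp only [integral_neg] at this ⊢
    rcases this with h | h
    · right; linarith
    · left; linarith

theorem IsStat.integrable [IsProbabilityMeasure P] (hf : IsStat P τ Φ R l f) : Integrable f P :=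
  Integrable.of_bound hf.meas.aestronglyMeasurable R (Eventually.of_forall hf.bdd)

theorem IsErgodicAction.ae_comp (hτ : IsErgodicAction P τ) (x : ℝ) {p : Ω → Prop}
    (hp : ∀ᵐ ω ∂P, p ω) : ∀ᵐ ω ∂P, p (τ x ω) :=
  (hτ.mp x).quasiMeasurePreserving.ae hp

theorem IsFlow.mono_level (hΦ : IsFlow τ Φ C) (hlm : l ≤ m) {x : ℝ} (hx : 0 ≤ x) (ω : Ω) (c : ℝ) :
    Φ l x ω c ≤ Φ m x ω c := by
  rcases hx.eq_or_lt with rfl | hx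
  · rw [hΦ.zero, hΦ.zero]
  rcases hlm.eq_or_lt with rfl | hlm
  · exact le_rfl
  exact (hΦ.lt_of_lt l m x ω c hlm hx).le

variable [IsProbabilityMeasure P]

theorem IsFlow.ae_le_or_ae_lt (hτ : IsErgodicAction P τ) (hΦ : IsFlow τ Φ C) (hlm : l ≤ m)
    (hf : IsStat P τ Φ R l f) (hg : IsStat P τ Φ R m g) :
    (∀ᵐ ω ∂P, f ω ≤ g ω) ∨ ∀ᵐ ω ∂P, g ω < f ω := by
  set A : Set Ω := {ω | f ω ≤ g ω} with hA
  have hAm : MeasurableSet A := measurableSet_le hf.meas hg.meas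
  have hpos : ∀ x, 0 ≤ x → ∀ᵐ ω ∂P, τ x ω ∈ A ↔ ω ∈ A := by
    intro x hx
    have hsub : A ≤ᵐ[P] τ x ⁻¹' A := by
      filter_upwards [hf.inv x, hg.inv x] with ω h1 h2 hω
      change f (τ x ω) ≤ g (τ x ω)
      rw [h1, h2]
      exact (hΦ.mono l x ω hω).trans (hΦ.mono_level hlm hx ω _)
    have heq := ae_eq_of_ae_subset_of_measure_ge hsub
      ((hτ.mp x).measure_preimage hAm.nullMeasurableSet).le hAm.nullMeasurableSet
      (measure_ne_top _ _)
    filter_upwards [heq.mem_iff] with ω hω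
    exact hω.symm
  have hinv : ∀ x, ∀ᵐ ω ∂P, τ x ω ∈ A ↔ ω ∈ A := by
    intro x
    rcases le_total 0 x with hx | hx
    · exact hpos x hx
    · filter_upwards [hτ.ae_comp x (hpos (-x) (by linarith))] with ω hω
      rw [← hτ.add, neg_add_cancel, hτ.zero] at hω
      exact hω.symm
  rcases hτ.ae_mem_or_ae_notMem hAm hinv with h | h
  · exact Or.inl h
  · right
    filter_upwards [h] with ω hω
    exact not_le.1 hω

theorem IsFlow.ae_le_of_integral_le (hτ : IsErgodicAction P τ) (hΦ : IsFlow τ Φ C)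
    (hf : IsStat P τ Φ R l f) (hg : IsStat P τ Φ R m g)
    (h : ∫ ω, f ω ∂P ≤ ∫ ω, g ω ∂P) : ∀ᵐ ω ∂P, f ω ≤ g ω := by
  have key : (∀ᵐ ω ∂P, g ω ≤ f ω) → ∀ᵐ ω ∂P, f ω ≤ g ω := by
    intro hle
    have := (integral_eq_iff_of_ae_le hg.integrable hf.integrable hle).1
      (le_antisymm (integral_mono_ae hg.integrable hf.integrable hle) h)
    filter_upwards [this] with ω hω using hω.ge
  rcases le_total l m with hlm | hlm
  · rcases hΦ.ae_le_or_ae_lt hτ hlm hf hg with h1 | h1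
    · exact h1
    · exact key (h1.mono fun ω h => h.le)
  · rcases hΦ.ae_le_or_ae_lt hτ hlm hg hf with h1 | h1
    · exact key h1
    · exact h1.mono fun ω h => h.le

theorem IsFlow.integral_ne (hτ : IsErgodicAction P τ) (hΦ : IsFlow τ Φ C) (hlm : l < m)
    (hf : IsStat P τ Φ R l f) (hg : IsStat P τ Φ R m g) :
    ∫ ω, f ω ∂P ≠ ∫ ω, g ω ∂P := by
  intro he
  have h0 : ∀ᵐ ω ∂P, f ω = g ω := by
    filter_upwards [hΦ.ae_le_of_integral_le hτ hf hg he.le,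
      hΦ.ae_le_of_integral_le hτ hg hf he.ge] with ω h1 h2
    exact le_antisymm h1 h2
  have : ∀ᵐ ω ∂P, False := by
    filter_upwards [h0, hτ.ae_comp 1 h0, hf.inv 1, hg.inv 1] with ω h1 h2 h3 h4
    rw [h3, h4, h1] at h2
    exact absurd h2 (hΦ.lt_of_lt l m 1 ω _ hlm one_pos).ne
  simp [IsProbabilityMeasure.ne_zero P] at this

theorem IsFlow.level_le (hτ : IsErgodicAction P τ) (hΦ : IsFlow τ Φ C)
    (hf : IsStat P τ Φ R l f) : l ≤ C := by
  by_contra hl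
  have h0 : ∀ᵐ ω ∂P, f ω ≤ f (τ 1 ω) := by
    filter_upwards [hf.inv 1] with ω hω
    rw [hω]
    exact (hΦ.lt_up l ω _ (not_le.1 hl)).le
  have hi : Integrable (fun ω => f (τ 1 ω)) P :=
    Integrable.of_bound (hf.meas.comp (hτ.measurable 1)).aestronglyMeasurable R
      (Eventually.of_forall fun ω => hf.bdd _)
  have h1 := (integral_eq_iff_of_ae_le hf.integrable hi h0).1 (hτ.integral_comp hf.meas 1).symm
  have : ∀ᵐ ω ∂P, False := by
    filter_upwards [h1, hf.inv 1] with ω h2 h3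
    rw [h3] at h2
    exact absurd h2 (hΦ.lt_up l ω _ (not_le.1 hl)).ne
  simp [IsProbabilityMeasure.ne_zero P] at this

theorem IsFlow.neg_le_level (hτ : IsErgodicAction P τ) (hΦ : IsFlow τ Φ C)
    (hf : IsStat P τ Φ R l f) : -C ≤ l := by
  have := hΦ.neg.level_le hτ hf.neg
  linarith

/-- A measurable subsolution whose forward orbit stays below `b₂` generates a stationary solution
between the two. -/
theorem IsFlow.exists_stat_between (hτ : IsErgodicAction P τ) (hΦ : IsFlow τ Φ C)
    {b₁ b₂ : Ω → ℝ} (hb₁ : Measurable b₁) (hR₁ : ∀ ω, |b₁ ω| ≤ R) (hR₂ : ∀ ω, |b₂ ω| ≤ R)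
    (h₁ : ∀ x, 0 ≤ x → ∀ᵐ ω ∂P, b₁ (τ x ω) ≤ Φ l x ω (b₁ ω))
    (h₂ : ∀ n : ℕ, ∀ᵐ ω ∂P, Φ l n ω (b₁ ω) ≤ b₂ (τ n ω)) :
    ∃ f, IsStat P τ Φ R l f ∧ (∀ᵐ ω ∂P, b₁ ω ≤ f ω) ∧ ∀ᵐ ω ∂P, f ω ≤ b₂ ω := by
  set G : ℝ → Ω → ℝ := fun t ω => Φ l t (τ (-t) ω) (b₁ (τ (-t) ω)) with hG
  have hGm : ∀ t, Measurable (G t) := fun t =>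
    (hΦ.meas l t).comp ((hτ.measurable _).prodMk (hb₁.comp (hτ.measurable _)))
  have hG0 : ∀ ω, G 0 ω = b₁ ω := fun ω => by simp [hG, hΦ.zero, hτ.zero]
  have hle₂ : ∀ᵐ ω ∂P, ∀ n : ℕ, G n ω ≤ b₂ ω := ae_all_iff.2 fun n => by
    filter_upwards [hτ.ae_comp (-n) (h₂ n)] with ω hω
    rwa [← hτ.add, add_neg_cancel, hτ.zero] at hω
  have hmono : ∀ s t, 0 ≤ s → s ≤ t → ∀ᵐ ω ∂P, G s ω ≤ G t ω := by
    intro s t hs hst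
    filter_upwards [hτ.ae_comp (-t) (h₁ (t - s) (by linarith))] with ω hω
    have e1 : τ (t - s) (τ (-t) ω) = τ (-s) ω := by rw [← hτ.add]; congr 1; ring
    have := hΦ.mono l s (τ (-s) ω) hω
    rw [e1] at this
    refine this.trans (le_of_eq ?_)
    rw [← e1, ← hΦ.add]
    simp [hG]
  have hshift : ∀ t x ω, G t (τ x ω) = Φ l x ω (G (t - x) ω) := by
    intro t x ω
    have e1 : τ (-t) (τ x ω) = τ (-(t - x)) ω := by rw [← hτ.add]; congr 1; ring
    have e2 : τ (t - x) (τ (-(t - x)) ω) = ω := by rw [← hτ.add]; simp [hτ.zero]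
    simp only [hG]
    have h1 := hΦ.add l x (t - x) (τ (-(t - x)) ω) (b₁ (τ (-(t - x)) ω))
    rw [e2, add_sub_cancel] at h1
    rw [e1, h1]
  have hmonoN : ∀ᵐ ω ∂P, Monotone fun n : ℕ => G n ω := by
    have : ∀ᵐ ω ∂P, ∀ n : ℕ, G n ω ≤ G (n + 1 : ℕ) ω := ae_all_iff.2 fun n =>
      hmono _ _ (by positivity) (by push_cast; linarith)
    filter_upwards [this] with ω hω using monotone_nat_of_le_succ hω
  set f : Ω → ℝ := fun ω => ⨆ n : ℕ, max (-R) (min R (G n ω)) with hf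
  have hclb : ∀ y : ℝ, 0 ≤ R → |max (-R) (min R y)| ≤ R := fun y hR =>
    abs_le.2 ⟨le_max_left _ _, max_le (by linarith) (min_le_left _ _)⟩
  have hR0 : 0 ≤ R := by
    obtain ⟨ω⟩ := nonempty_of_isProbabilityMeasure P
    exact (abs_nonneg _).trans (hR₁ ω)
  have hbdd : ∀ ω, BddAbove (range fun n : ℕ => max (-R) (min R (G n ω))) := fun ω =>
    ⟨R, by rintro _ ⟨n, rfl⟩; exact (abs_le.1 (hclb _ hR0)).2⟩
  have hfm : Measurable f :=
    Measurable.iSup fun n => measurable_const.max (measurable_const.min (hGm n))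
  have hfb : ∀ ω, |f ω| ≤ R := fun ω => abs_le.2
    ⟨(abs_le.1 (hclb _ hR0)).1.trans (le_ciSup (hbdd ω) 0),
      ciSup_le fun n => (abs_le.1 (hclb _ hR0)).2⟩
  have hlim : ∀ᵐ ω ∂P, Tendsto (fun n : ℕ => G n ω) atTop (nhds (f ω)) := by
    filter_upwards [hle₂, hmonoN] with ω h1 h2
    have e : ∀ n : ℕ, max (-R) (min R (G n ω)) = G n ω := fun n => by
      have a1 : b₁ ω ≤ G n ω := by
        have := h2 (Nat.zero_le n)
        simpa [hG0] using this
      have a2 := h1 n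
      have a3 := (abs_le.1 (hR₁ ω)).1
      have a4 := (abs_le.1 (hR₂ ω)).2
      rw [min_eq_right (by linarith), max_eq_right (by linarith)]
    have hb := hbdd ω
    simp only [hf, e] at hb ⊢
    exact tendsto_atTop_ciSup h2 hb
  refine ⟨f, ⟨hfm, hfb, fun x => ?_⟩, ?_, ?_⟩
  · have hfl : ∀ᵐ ω ∂P, ∀ n : ℕ, 0 ≤ (n : ℝ) - x →
        G ⌊(n : ℝ) - x⌋₊ ω ≤ G (n - x) ω ∧ G (n - x) ω ≤ G (⌊(n : ℝ) - x⌋₊ + 1 : ℕ) ω := by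
      refine ae_all_iff.2 fun n => ?_
      by_cases hn : 0 ≤ (n : ℝ) - x
      · filter_upwards [hmono _ _ (Nat.cast_nonneg _) (Nat.floor_le hn),
          hmono _ ((⌊(n : ℝ) - x⌋₊ + 1 : ℕ) : ℝ) hn
            (by push_cast; exact (Nat.lt_floor_add_one _).le)] with ω a1 a2 _
        exact ⟨a1, a2⟩
      · exact Eventually.of_forall fun ω h => absurd h hn
    filter_upwards [hfl, hlim, hτ.ae_comp x hlim] with ω h1 h2 h3
    have hsub : Tendsto (fun n : ℕ => (n : ℝ) - x) atTop atTop := by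
      simpa [sub_eq_add_neg] using
        tendsto_atTop_add_const_right _ (-x) (tendsto_natCast_atTop_atTop (R := ℝ))
    have hfloor : Tendsto (fun n : ℕ => ⌊(n : ℝ) - x⌋₊) atTop atTop :=
      tendsto_nat_floor_atTop.comp hsub
    have hmid : Tendsto (fun n : ℕ => G (n - x) ω) atTop (nhds (f ω)) := by
      refine tendsto_of_tendsto_of_tendsto_of_le_of_le' (h2.comp hfloor)
        (h2.comp ((tendsto_add_atTop_nat 1).comp hfloor)) ?_ ?_
      · filter_upwards [hsub.eventually_ge_atTop 0] with n hn using (h1 n hn).1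
      · filter_upwards [hsub.eventually_ge_atTop 0] with n hn using (h1 n hn).2
    have h4 := ((hΦ.continuous_right l x ω).tendsto _).comp hmid
    refine tendsto_nhds_unique h3 (h4.congr fun n => ?_)
    exact (hshift n x ω).symm
  · filter_upwards [hlim, hmonoN] with ω h1 h2
    have := h2.ge_of_tendsto h1 0
    simpa [hG0] using this
  · filter_upwards [hlim, hle₂] with ω h1 h2
    refine le_of_tendsto' h1 ?_
    exact h2

/-- Between stationary solutions at increasing levels there are intermediate ones. -/
theorem IsFlow.level_ge_of_gap (hτ : IsErgodicAction P τ) (hΦ : IsFlow τ Φ C)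
    (hf : IsStat P τ Φ R l f) (hg : IsStat P τ Φ R m g) (hlt : ∫ ω, f ω ∂P < ∫ ω, g ω ∂P)
    (hgap : ∀ k h, IsStat P τ Φ R k h →
      ∫ ω, h ω ∂P ≤ ∫ ω, f ω ∂P ∨ ∫ ω, g ω ∂P ≤ ∫ ω, h ω ∂P) : m ≤ l := by
  by_contra hlm
  rw [not_le] at hlm
  have hle := hΦ.ae_le_of_integral_le hτ hf hg hlt.le
  obtain ⟨h, hh, h1, h2⟩ := hΦ.exists_stat_between (l := (l + m) / 2) hτ hf.meas hf.bdd hg.bdd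
    (fun x hx => by
      filter_upwards [hf.inv x] with ω hω
      rw [hω]
      exact hΦ.mono_level (by linarith) hx ω _)
    (fun n => by
      filter_upwards [hg.inv n, hle] with ω hω hle
      rw [hω]
      exact (hΦ.mono _ _ ω hle).trans (hΦ.mono_level (by linarith) (Nat.cast_nonneg n) ω _))
  have i1 := integral_mono_ae hf.integrable hh.integrable h1
  have i2 := integral_mono_ae hh.integrable hg.integrable h2
  rcases hgap _ h hh with h3 | h3
  · exact hΦ.integral_ne hτ (by linarith) hf hh (le_antisymm i1 h3)
  · exact hΦ.integral_ne hτ (by linarith) hh hg (le_antisymm i2 h3)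

theorem IsFlow.level_eq_of_gap (hτ : IsErgodicAction P τ) (hΦ : IsFlow τ Φ C)
    (hf : IsStat P τ Φ R l f) (hg : IsStat P τ Φ R m g) (hlt : ∫ ω, f ω ∂P < ∫ ω, g ω ∂P)
    (hgap : ∀ k h, IsStat P τ Φ R k h →
      ∫ ω, h ω ∂P ≤ ∫ ω, f ω ∂P ∨ ∫ ω, g ω ∂P ≤ ∫ ω, h ω ∂P) : l = m := by
  refine le_antisymm ?_ (hΦ.level_ge_of_gap hτ hf hg hlt hgap)
  refine hΦ.reflect.level_ge_of_gap hτ.reflect hg.reflect hf.reflect ?_ fun k h hh => ?_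
  · simpa only [integral_neg, neg_lt_neg_iff] using hlt
  · have := hgap _ _ hh.of_reflect
    simp only [integral_neg] at this ⊢
    rcases this with h | h
    · right; linarith
    · left; linarith

/-- Above the level of a gap, orbits cross the gap with positive probability. -/
theorem IsGap.exists_crossing (hτ : IsErgodicAction P τ) (hΦ : IsFlow τ Φ C) {f₁ f₂ : Ω → ℝ}
    (h : IsGap P τ Φ R l f₁ f₂) (hlm : l < m) :
    ∃ n : ℕ, ¬ ∀ᵐ ω ∂P, Φ m n ω (f₁ ω) ≤ Φ l n ω (f₂ ω) := by
  by_contra hcon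
  push Not at hcon
  obtain ⟨g, hg, h1, h2⟩ := hΦ.exists_stat_between (l := m) hτ h.left.meas h.left.bdd h.right.bdd
    (fun x hx => by
      filter_upwards [h.left.inv x] with ω hω
      rw [hω]
      exact hΦ.mono_level hlm.le hx ω _)
    (fun n => by
      filter_upwards [h.right.inv n, hcon n] with ω hω hle
      rwa [hω])
  have i1 := integral_mono_ae h.left.integrable hg.integrable h1
  have i2 := integral_mono_ae hg.integrable h.right.integrable h2
  rcases h.gap _ g hg with h3 | h3
  · exact hΦ.integral_ne hτ hlm h.left hg (le_antisymm i1 h3)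
  · exact hΦ.integral_ne hτ hlm h.right hg (le_antisymm h3 i2)

theorem IsFlow.exists_max_stat (hτ : IsErgodicAction P τ) (hΦ : IsFlow τ Φ C) {θ : ℝ}
    (hf : IsStat P τ Φ R l f) (hfθ : ∫ ω, f ω ∂P ≤ θ) :
    ∃ m g, IsStat P τ Φ R m g ∧ ∫ ω, g ω ∂P ≤ θ ∧
      ∀ k h, IsStat P τ Φ R k h → ∫ ω, h ω ∂P ≤ θ → ∫ ω, h ω ∂P ≤ ∫ ω, g ω ∂P := by
  set S : Set ℝ := {s | s ≤ θ ∧ ∃ k h, IsStat P τ Φ R k h ∧ ∫ ω, h ω ∂P = s} with hS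
  have hne : S.Nonempty := ⟨_, hfθ, l, f, hf, rfl⟩
  have hbd : BddAbove S := ⟨θ, fun s hs => hs.1⟩
  obtain ⟨u, humono, hulim, huS⟩ := exists_seq_tendsto_sSup hne hbd
  choose hle k h hh hint using huS
  have hmono : ∀ᵐ ω ∂P, Monotone fun n => h n ω := by
    have : ∀ᵐ ω ∂P, ∀ n, h n ω ≤ h (n + 1) ω := ae_all_iff.2 fun n =>
      hΦ.ae_le_of_integral_le hτ (hh n) (hh (n + 1)) (by
        rw [hint, hint]; exact humono (Nat.le_succ n))
    filter_upwards [this] with ω hω using monotone_nat_of_le_succ hω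
  obtain ⟨m, -, φ, hφ, hφlim⟩ := (isCompact_Icc (a := -C) (b := C)).tendsto_subseq (x := k)
    fun n => ⟨hΦ.neg_le_level hτ (hh n), hΦ.level_le hτ (hh n)⟩
  set g : Ω → ℝ := fun ω => ⨆ n, h n ω with hg
  have hbdd : ∀ ω, BddAbove (range fun n => h n ω) := fun ω =>
    ⟨R, by rintro _ ⟨n, rfl⟩; exact (abs_le.1 ((hh n).bdd ω)).2⟩
  have hlim : ∀ᵐ ω ∂P, Tendsto (fun n => h (φ n) ω) atTop (nhds (g ω)) := by
    filter_upwards [hmono] with ω hω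
    exact (tendsto_atTop_ciSup hω (hbdd ω)).comp hφ.tendsto_atTop
  have hgint : ∫ ω, g ω ∂P = sSup S := by
    have h1 : Tendsto (fun n => ∫ ω, h (φ n) ω ∂P) atTop (nhds (∫ ω, g ω ∂P)) :=
      tendsto_integral_of_dominated_convergence (fun _ => R)
        (fun n => (hh (φ n)).meas.aestronglyMeasurable) (integrable_const R)
        (fun n => Eventually.of_forall (hh (φ n)).bdd) hlim
    simp only [hint] at h1
    exact tendsto_nhds_unique h1 (hulim.comp hφ.tendsto_atTop)
  refine ⟨m, g, ⟨Measurable.iSup fun n => (hh n).meas, fun ω => ?_, fun x => ?_⟩, ?_, ?_⟩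
  · exact abs_le.2 ⟨(abs_le.1 ((hh 0).bdd ω)).1.trans (le_ciSup (hbdd ω) 0),
      ciSup_le fun n => (abs_le.1 ((hh n).bdd ω)).2⟩
  · have hinv : ∀ᵐ ω ∂P, ∀ n, h n (τ x ω) = Φ (k n) x ω (h n ω) :=
      ae_all_iff.2 fun n => (hh n).inv x
    filter_upwards [hinv, hlim, hτ.ae_comp x hlim] with ω h1 h2 h3
    have h4 := ((hΦ.cont x ω).tendsto (m, g ω)).comp (hφlim.prodMk_nhds h2)
    refine tendsto_nhds_unique h3 (h4.congr fun n => ?_)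
    simp [h1]
  · rw [hgint]
    exact csSup_le hne fun s hs => hs.1
  · intro l f hf hfle
    rw [hgint]
    exact le_csSup hbd ⟨hfle, l, f, hf, rfl⟩

/-- Every mean between those of two stationary solutions is either attained by a stationary
solution or lies in a gap. -/
theorem IsFlow.stat_or_gap (hτ : IsErgodicAction P τ) (hΦ : IsFlow τ Φ C) {θ : ℝ}
    (hf : IsStat P τ Φ R l f) (hg : IsStat P τ Φ R m g)
    (hfθ : ∫ ω, f ω ∂P ≤ θ) (hgθ : θ ≤ ∫ ω, g ω ∂P) :
    ∃ k, (∃ h, IsStat P τ Φ R k h ∧ ∫ ω, h ω ∂P = θ) ∨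
      ∃ f₁ f₂, IsGap P τ Φ R k f₁ f₂ ∧ ∫ ω, f₁ ω ∂P < θ ∧ θ < ∫ ω, f₂ ω ∂P := by
  obtain ⟨k₁, f₁, hf₁, h₁, hmax⟩ := hΦ.exists_max_stat hτ hf hfθ
  obtain ⟨k₂, f₂, hf₂, h₂, hmin⟩ := hΦ.neg.exists_max_stat (θ := -θ) hτ hg.neg (by
    rw [integral_neg]; linarith)
  have hf₂' := hf₂.of_neg
  set g₂ : Ω → ℝ := fun ω => -f₂ ω with hg₂
  have e : ∫ ω, g₂ ω ∂P = -∫ ω, f₂ ω ∂P := integral_neg _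
  rcases h₁.eq_or_lt with h | h₁
  · exact ⟨k₁, Or.inl ⟨f₁, hf₁, h⟩⟩
  rcases h₂.eq_or_lt with h | h₂
  · exact ⟨-k₂, Or.inl ⟨g₂, hf₂', by rw [e]; linarith⟩⟩
  have hgap : ∀ k h, IsStat P τ Φ R k h →
      ∫ ω, h ω ∂P ≤ ∫ ω, f₁ ω ∂P ∨ ∫ ω, g₂ ω ∂P ≤ ∫ ω, h ω ∂P := by
    intro k h hh
    rcases le_total (∫ ω, h ω ∂P) θ with hle | hle
    · exact Or.inl (hmax k h hh hle)
    · right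
      have := hmin _ _ hh.neg (by rw [integral_neg]; linarith)
      rw [integral_neg] at this
      linarith
  have hlt : ∫ ω, f₁ ω ∂P < ∫ ω, g₂ ω ∂P := by linarith
  have heq := hΦ.level_eq_of_gap hτ hf₁ hf₂' hlt hgap
  refine ⟨k₁, Or.inr ⟨f₁, g₂, ⟨hf₁, heq ▸ hf₂', hlt, hgap⟩, h₁, by linarith⟩⟩

theorem IsFlow.exists_stat_of_barriers (hτ : IsErgodicAction P τ) (hΦ : IsFlow τ Φ C) {b : ℝ}
    (hb : 0 ≤ b) (hbR : b ≤ R) (h₁ : ∀ x ω, 0 ≤ x → b ≤ Φ l x ω b)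
    (h₂ : ∀ x ω, 0 ≤ x → Φ l x ω R ≤ R) :
    ∃ f, IsStat P τ Φ R l f ∧ b ≤ ∫ ω, f ω ∂P := by
  obtain ⟨f, hf, h3, -⟩ := hΦ.exists_stat_between (l := l) (R := R) hτ (b₁ := fun _ => b)
    (b₂ := fun _ => R) measurable_const (fun ω => by rw [abs_of_nonneg hb]; exact hbR)
    (fun ω => by rw [abs_of_nonneg (hb.trans hbR)])
    (fun x hx => Eventually.of_forall fun ω => h₁ x ω hx)
    (fun n => Eventually.of_forall fun ω =>
      (hΦ.mono l n ω hbR).trans (h₂ n ω (Nat.cast_nonneg n)))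
  refine ⟨f, hf, ?_⟩
  have := integral_mono_ae (integrable_const b) hf.integrable h3
  simpa using this

theorem IsFlow.exists_stat_of_neg_barriers (hτ : IsErgodicAction P τ) (hΦ : IsFlow τ Φ C) {b : ℝ}
    (hb : 0 ≤ b) (hbR : b ≤ R) (h₁ : ∀ x ω, 0 ≤ x → -b ≤ Φ l x ω (-b))
    (h₂ : ∀ x ω, 0 ≤ x → Φ l x ω (-R) ≤ -R) :
    ∃ f, IsStat P τ Φ R l f ∧ ∫ ω, f ω ∂P ≤ -b := by
  have inv : ∀ x ω c, Φ l (-x) ω (Φ l x (τ (-x) ω) c) = c := fun x ω c => by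
    have := hΦ.inv l x (τ (-x) ω) c
    rwa [← hτ.add, add_neg_cancel, hτ.zero] at this
  obtain ⟨f, hf, h3⟩ := hΦ.reflect.exists_stat_of_barriers (l := l) (R := R) hτ.reflect hb hbR
    (fun x ω hx => by
      have := hΦ.mono l (-x) ω (h₁ x (τ (-x) ω) hx)
      rw [inv] at this
      linarith)
    (fun x ω hx => by
      have := hΦ.mono l (-x) ω (h₂ x (τ (-x) ω) hx)
      rw [inv] at this
      linarith)
  refine ⟨_, hf.of_reflect, ?_⟩
  rw [integral_neg]
  linarith

end Stat

/-- `f` is a subsolution at level `l` of the stationary equation, in the sense of upper derivatives. -/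
def IsSuperSlope (α : ℝ → ℝ) (h : ℝ → ℝ → ℝ) (l : ℝ) (f : ℝ → ℝ) : Prop :=
  ∀ x₀ s, (l - h (f x₀) x₀) / α x₀ < s →
    ∀ᶠ x in nhds x₀, (f x - f x₀) * (x - x₀) ≤ s * (x - x₀) ^ 2

/-- Approximate correctors: stationary supersolutions at level `l + κ`, of slope roughly `θ`, which
are nearly tangent from above to the line `x ↦ θ x` at any prescribed point. -/
def HasCorrectors (α : ℝ → ℝ) (h : ℝ → ℝ → ℝ) (R θ l κ : ℝ) : Prop :=
  ∃ C, 0 ≤ C ∧ ∀ y, ∃ f F : ℝ → ℝ, (∀ x, HasDerivAt F (f x) x) ∧ (∀ x, |f x| ≤ R) ∧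
    IsSuperSlope α h (l + κ) f ∧ (∀ x, θ * x - κ * |x| - κ * |y| - C ≤ F x) ∧
    F y ≤ θ * y + κ * |y| + C

section Slope

variable {α : ℝ → ℝ} {h : ℝ → ℝ → ℝ} {l m : ℝ} {f g : ℝ → ℝ}

theorem IsSuperSlope.mono_level (hα : ∀ x, 0 < α x) (hf : IsSuperSlope α h l f) (hlm : l ≤ m) :
    IsSuperSlope α h m f := fun x₀ s hs => hf x₀ s (lt_of_le_of_lt (by
      have := hα x₀
      gcongr) hs)

theorem IsSuperSlope.congr {h' : ℝ → ℝ → ℝ} (hf : IsSuperSlope α h l f)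
    (hh : ∀ x, h (f x) x = h' (f x) x) : IsSuperSlope α h' l f := fun x₀ s hs =>
  hf x₀ s (by rwa [hh])

theorem IsSuperSlope.of_hasDerivAt (hf : ∀ x, HasDerivAt f ((l - h (f x) x) / α x) x) :
    IsSuperSlope α h l f := by
  intro x₀ s hs
  have h1 := (hasDerivAt_iff_isLittleO.1 (hf x₀)).def (sub_pos.2 hs)
  filter_upwards [h1] with x hx
  rw [Real.norm_eq_abs, Real.norm_eq_abs, smul_eq_mul] at hx
  have h2 := mul_le_mul_of_nonneg_right hx (abs_nonneg (x - x₀))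
  rw [← abs_mul, mul_assoc, abs_mul_abs_self] at h2
  have h3 := (abs_le.1 h2).2
  nlinarith

theorem IsSuperSlope.of_eventually {k : ℝ → ℝ} (hf : IsSuperSlope α h l f)
    (hg : IsSuperSlope α h l g)
    (hk : ∀ x₀, ∀ᶠ x in nhds x₀, (k x = f x ∧ k x₀ = f x₀) ∨ (k x = g x ∧ k x₀ = g x₀)) :
    IsSuperSlope α h l k := by
  intro x₀ s hs
  by_cases h1 : k x₀ = f x₀ <;> by_cases h2 : k x₀ = g x₀
  · filter_upwards [hk x₀, hf x₀ s (h1 ▸ hs), hg x₀ s (h2 ▸ hs)] with x h3 h4 h5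
    rcases h3 with ⟨h3, -⟩ | ⟨h3, -⟩
    · rwa [h3, h1]
    · rwa [h3, h2]
  · filter_upwards [hk x₀, hf x₀ s (h1 ▸ hs)] with x h3 h4
    rcases h3 with ⟨h3, -⟩ | ⟨h3, h6⟩
    · rwa [h3, h1]
    · exact absurd h6 h2
  · filter_upwards [hk x₀, hg x₀ s (h2 ▸ hs)] with x h3 h4
    rcases h3 with ⟨h3, h6⟩ | ⟨h3, -⟩
    · exact absurd h6 h1
    · rwa [h3, h2]
  · filter_upwards [hk x₀] with x h3
    rcases h3 with ⟨h3, h6⟩ | ⟨h3, h6⟩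
    · exact absurd h6 h1
    · exact absurd h6 h2

theorem IsSuperSlope.min (hfc : Continuous f) (hgc : Continuous g) (hf : IsSuperSlope α h l f)
    (hg : IsSuperSlope α h l g) : IsSuperSlope α h l fun x => min (f x) (g x) := by
  refine hf.of_eventually hg fun x₀ => ?_
  rcases lt_trichotomy (f x₀) (g x₀) with h1 | h1 | h1
  · filter_upwards [hfc.continuousAt.eventually_lt hgc.continuousAt h1] with x hx
    exact Or.inl ⟨min_eq_left hx.le, min_eq_left h1.le⟩
  · refine Eventually.of_forall fun x => ?_
    rcases min_choice (f x) (g x) with h2 | h2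
    · exact Or.inl ⟨h2, min_eq_left h1.le⟩
    · exact Or.inr ⟨h2, min_eq_right h1.ge⟩
  · filter_upwards [hgc.continuousAt.eventually_lt hfc.continuousAt h1] with x hx
    exact Or.inr ⟨min_eq_right hx.le, min_eq_right h1.le⟩

theorem IsSuperSlope.max (hfc : Continuous f) (hgc : Continuous g) (hf : IsSuperSlope α h l f)
    (hg : IsSuperSlope α h l g) : IsSuperSlope α h l fun x => max (f x) (g x) := by
  refine hf.of_eventually hg fun x₀ => ?_
  rcases lt_trichotomy (f x₀) (g x₀) with h1 | h1 | h1
  · filter_upwards [hfc.continuousAt.eventually_lt hgc.continuousAt h1] with x hx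
    exact Or.inr ⟨max_eq_right hx.le, max_eq_right h1.le⟩
  · refine Eventually.of_forall fun x => ?_
    rcases max_choice (f x) (g x) with h2 | h2
    · exact Or.inl ⟨h2, max_eq_left h1.ge⟩
    · exact Or.inr ⟨h2, max_eq_right h1.le⟩
  · filter_upwards [hgc.continuousAt.eventually_lt hfc.continuousAt h1] with x hx
    exact Or.inl ⟨max_eq_left hx.le, max_eq_left h1.le⟩

theorem HasCorrectors.mono {R θ κ κ' : ℝ} (hα : ∀ x, 0 < α x) (hc : HasCorrectors α h R θ l κ)
    (hκ : κ ≤ κ') : HasCorrectors α h R θ l κ' := by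
  obtain ⟨C, hC, H⟩ := hc
  refine ⟨C, hC, fun y => ?_⟩
  obtain ⟨f, F, h1, h2, h3, h4, h5⟩ := H y
  refine ⟨f, F, h1, h2, h3.mono_level hα (by linarith), fun x => ?_, ?_⟩
  · have := h4 x
    have := mul_le_mul_of_nonneg_right hκ (abs_nonneg x)
    have := mul_le_mul_of_nonneg_right hκ (abs_nonneg y)
    linarith
  · have := mul_le_mul_of_nonneg_right hκ (abs_nonneg y)
    linarith

theorem HasCorrectors.congr {R θ κ : ℝ} {h' : ℝ → ℝ → ℝ} (hc : HasCorrectors α h R θ l κ)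
    (hh : ∀ p x, |p| ≤ R → h p x = h' p x) : HasCorrectors α h' R θ l κ := by
  obtain ⟨C, hC, H⟩ := hc
  refine ⟨C, hC, fun y => ?_⟩
  obtain ⟨f, F, h1, h2, h3, h4, h5⟩ := H y
  exact ⟨f, F, h1, h2, h3.congr fun x => hh _ _ (h2 x), h4, h5⟩

end Slope

section Medium

variable {Ω : Type*} [MeasurableSpace Ω] {P : Measure Ω} {τ : ℝ → Ω → Ω} {α : Ω → ℝ}
  {η : ℝ → Ω → ℝ} {K : NNReal} {C R l m θ κ : ℝ} {f g : Ω → ℝ} {Φ : ℝ → ℝ → Ω → ℝ → ℝ}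

theorem IsMedium.neg (h : IsMedium τ α η K C) : IsMedium τ α (fun p ω => -η (-p) ω) K C where
  toIsAction := h.toIsAction
  alpha_meas := h.alpha_meas
  alpha_pos := h.alpha_pos
  alpha_cont := h.alpha_cont
  eta_meas p := (h.eta_meas (-p)).neg
  eta_lip ω := by
    refine LipschitzWith.of_dist_le_mul fun p q => ?_
    have := (h.eta_lip ω).dist_le_mul (-p) (-q)
    rwa [dist_neg_neg] at this ⊢
  eta_bdd p ω := by simpa using h.eta_bdd (-p) ω
  eta_cont p ω := (h.eta_cont (-p) ω).neg

theorem IsMedium.flow_neg (h : IsMedium τ α η K C) :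
    h.neg.flow = fun l x ω c => -h.flow (-l) x ω (-c) := by
  funext l x ω c
  refine congrFun (IsGlobalSol.eq_of_eq (h.neg.isTameField l ω) (h.neg.flow_isGlobalSol l ω c)
    (h := fun x => -h.flow (-l) x ω (-c)) (fun x => ?_) (x₀ := 0) ?_) x
  · have := (h.flow_isGlobalSol (-l) ω (-c) x).neg
    convert! this using 1
    simp only [drift, neg_neg]
    ring
  · simp [h.flow_zero, h.neg.flow_zero]

theorem IsMedium.isSuperSlope_flow (h : IsMedium τ α η K C) (l y : ℝ) (ω : Ω) (c : ℝ) :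
    IsSuperSlope (fun x => α (τ x ω)) (fun p x => η p (τ x ω)) l
      fun x => h.flow l (x - y) (τ y ω) c := by
  refine IsSuperSlope.of_hasDerivAt fun x => ?_
  have := (h.flow_isGlobalSol l (τ y ω) c (x - y)).comp x ((hasDerivAt_id x).sub_const y)
  simpa [drift, ← h.add, Function.comp_def] using! this

/-- Along almost every path a stationary solution is an orbit of the flow, bounded, and with the
expected average. -/
theorem IsStat.ae_path [IsProbabilityMeasure P] (hτ : IsErgodicAction P τ) (hΦ : IsFlow τ Φ C)
    (hf : IsStat P τ Φ R l f) : ∀ᵐ ω ∂P, (∀ᵐ s : ℝ, f (τ s ω) = Φ l s ω (f ω)) ∧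
      (∀ s, |Φ l s ω (f ω)| ≤ R) ∧ ∀ κ > 0, ∃ D, 0 ≤ D ∧ ∀ x,
        |(∫ s in 0..x, Φ l s ω (f ω)) - x * ∫ ω, f ω ∂P| ≤ κ * |x| + D := by
  have hms : MeasurableSet {q : Ω × ℝ | f (τ q.2 q.1) = Φ l q.2 q.1 (f q.1)} := by
    refine measurableSet_eq_fun (hf.meas.comp (hτ.meas.comp measurable_swap)) ?_
    exact (hΦ.measurable_joint l).comp
      (measurable_snd.prodMk (measurable_fst.prodMk (hf.meas.comp measurable_fst)))
  have hae : ∀ᵐ ω ∂P, ∀ᵐ s : ℝ, f (τ s ω) = Φ l s ω (f ω) := by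
    rw [← Measure.ae_prod_iff_ae_ae hms]
    have : ∀ᵐ q : ℝ × Ω ∂(volume.prod P), f (τ q.1 q.2) = Φ l q.1 q.2 (f q.2) :=
      (Measure.ae_prod_iff_ae_ae (p := fun q : ℝ × Ω => f (τ q.1 q.2) = Φ l q.1 q.2 (f q.2))
        (measurable_swap hms)).2 (Eventually.of_forall hf.inv)
    rw [← Measure.prod_swap, ae_map_iff measurable_swap.aemeasurable hms]
    exact this
  filter_upwards [hae, hτ.ae_abs_integral_sub_le hf.meas hf.bdd] with ω h1 h2
  refine ⟨h1, ?_, fun κ hκ => ?_⟩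
  · have hcont : Continuous fun s => |Φ l s ω (f ω)| := (hΦ.cont_x l ω (f ω)).abs
    have hopen : IsOpen {s | R < |Φ l s ω (f ω)|} := isOpen_lt continuous_const hcont
    have hnull : volume {s | R < |Φ l s ω (f ω)|} = 0 := by
      refine measure_eq_zero_iff_ae_notMem.2 ?_
      filter_upwards [h1] with s hs hlt
      have := hf.bdd (τ s ω)
      rw [hs] at this
      exact absurd hlt (not_lt.2 this)
    intro s
    by_contra hs
    have : s ∈ {s | R < |Φ l s ω (f ω)|} := not_le.1 hs
    rw [(hopen.measure_eq_zero_iff volume).1 hnull] at this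
    exact this
  · obtain ⟨D, hD⟩ := h2 κ hκ
    refine ⟨D, by simpa using hD 0, fun x => ?_⟩
    have e : ∫ s in 0..x, Φ l s ω (f ω) = ∫ s in 0..x, f (τ s ω) := by
      refine intervalIntegral.integral_congr_ae ?_
      filter_upwards [h1] with s hs _ using hs.symm
    rw [e]
    exact hD x

theorem IsMedium.hasCorrectors_of_stat [IsProbabilityMeasure P] (hτ : IsErgodicAction P τ)
    (h : IsMedium τ α η K C) (hf : IsStat P τ h.flow R l f) (hκ : 0 < κ) :
    ∀ᵐ ω ∂P, HasCorrectors (fun x => α (τ x ω)) (fun p x => η p (τ x ω)) R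
      (∫ ω, f ω ∂P) l κ := by
  filter_upwards [hf.ae_path hτ h.isFlow] with ω ⟨_, hbd, herg⟩
  obtain ⟨D, hD0, hD⟩ := herg κ hκ
  refine ⟨D, hD0, fun y => ⟨fun x => h.flow l x ω (f ω),
    fun x => ∫ s in 0..x, h.flow l s ω (f ω), fun x => ?_, hbd, ?_, fun x => ?_, ?_⟩⟩
  · exact ((h.isFlow.cont_x l ω (f ω)).integral_hasStrictDerivAt 0 x).hasDerivAt
  · have := h.isSuperSlope_flow l 0 ω (f ω)
    simp only [sub_zero, h.zero] at this
    exact this.mono_level (fun x => h.alpha_pos _) (by linarith)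
  · have := (abs_le.1 (hD x)).1
    have := mul_nonneg hκ.le (abs_nonneg y)
    linarith
  · have := (abs_le.1 (hD y)).2
    linarith

/-- Visits to a set of positive measure occur in every window of slowly growing length. -/
theorem IsErgodicAction.ae_exists_visit [IsProbabilityMeasure P] (hτ : IsErgodicAction P τ)
    {B : Set Ω} (hB : MeasurableSet B) (hpos : ¬ ∀ᵐ ω ∂P, ω ∉ B) (hκ : 0 < κ) :
    ∀ᵐ ω ∂P, ∃ D, 0 ≤ D ∧ ∀ y, ∀ p : ℝ → Prop, (∀ᵐ s, p s) →
      ∃ Y, y ≤ Y ∧ Y ≤ y + κ * |y| + D ∧ τ Y ω ∈ B ∧ p Y := by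
  set X : Ω → ℝ := B.indicator 1 with hX
  have hXm : Measurable X := measurable_one.indicator hB
  have hXb : ∀ ω, |X ω| ≤ 1 := fun ω => by
    by_cases h : ω ∈ B <;> simp [hX, h]
  have hXi : ∫ ω, X ω ∂P = P.real B := integral_indicator_one hB
  have hb : 0 < P.real B := by
    rw [measureReal_def, ENNReal.toReal_pos_iff]
    refine ⟨pos_iff_ne_zero.2 fun h0 => hpos (measure_eq_zero_iff_ae_notMem.1 h0),
      measure_lt_top _ _⟩
  set b := P.real B with hbdef
  filter_upwards [hτ.ae_abs_integral_sub_le hXm hXb] with ω hω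
  set ε := min (b / 2) (b * κ / 4) with hε
  have hε0 : 0 < ε := lt_min (by positivity) (by positivity)
  have hε1 : ε ≤ b / 2 := min_le_left _ _
  have hε2 : ε ≤ b * κ / 4 := min_le_right _ _
  obtain ⟨D, hD⟩ := hω ε hε0
  have hD0 : 0 ≤ D := by simpa using hD 0
  refine ⟨4 * D / b + 1, by positivity, fun y p hp => ?_⟩
  set L := κ * |y| + (4 * D / b + 1) with hL
  have hL0 : 0 < L := by positivity
  by_contra hcon
  push Not at hcon
  have hzero : ∫ s in y..(y + L), X (τ s ω) = 0 := by
    have : ∫ s in y..(y + L), X (τ s ω) = ∫ s in y..(y + L), (0 : ℝ) := by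
      refine intervalIntegral.integral_congr_ae ?_
      filter_upwards [hp] with s hs hmem
      rw [uIoc_of_le (by linarith)] at hmem
      have : τ s ω ∉ B := fun hB => hcon s hmem.1.le (by linarith [hmem.2]) hB hs
      simp [hX, this]
    simpa using this
  have hsplit : (∫ s in 0..(y + L), X (τ s ω)) = (∫ s in 0..y, X (τ s ω)) +
      ∫ s in y..(y + L), X (τ s ω) :=
    (intervalIntegral.integral_add_adjacent_intervals (hτ.intervalIntegrable hXm hXb ω _ _)
      (hτ.intervalIntegrable hXm hXb ω _ _)).symm
  have h1 := (abs_le.1 (hD (y + L))).1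
  have h2 := (abs_le.1 (hD y)).2
  rw [hXi] at h1 h2
  have h3 : |y + L| ≤ |y| + L := (abs_add_le _ _).trans (by rw [abs_of_pos hL0])
  have h4 : ε * |y + L| ≤ ε * (|y| + L) := by gcongr
  have h5 : ε * L ≤ b / 2 * L := by gcongr
  have h6 : ε * |y| ≤ b * κ / 4 * |y| := by gcongr
  have h7 : b / 2 * L = b * κ / 2 * |y| + 2 * D + b / 2 := by
    rw [hL]; field_simp; ring
  linarith

end Medium

section Gap

variable {Ω : Type*} [MeasurableSpace Ω] {P : Measure Ω} {τ : ℝ → Ω → Ω} {α : Ω → ℝ}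
  {η : ℝ → Ω → ℝ} {K : NNReal} {C R l m θ κ : ℝ} {f₁ f₂ : Ω → ℝ} {Φ : ℝ → ℝ → Ω → ℝ → ℝ}

theorem IsFlow.mono_level_neg (hΦ : IsFlow τ Φ C) (hlm : l ≤ m) {x : ℝ} (hx : x ≤ 0) (ω : Ω)
    (c : ℝ) : Φ m x ω c ≤ Φ l x ω c := by
  rcases hx.eq_or_lt with rfl | hx
  · rw [hΦ.zero, hΦ.zero]
  rcases hlm.eq_or_lt with rfl | hlm
  · exact le_rfl
  have := hΦ.lt_of_lt_neg hlm (neg_pos.2 hx) ω c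
  rw [neg_neg] at this
  exact this.le

theorem IsFlow.add_sub (hΦ : IsFlow τ Φ C) (l x Y : ℝ) (ω : Ω) (c : ℝ) :
    Φ l (x - Y) (τ Y ω) (Φ l Y ω c) = Φ l x ω c := by
  rw [← hΦ.add, sub_add_cancel]

/-- An orbit at a higher level which starts on a stationary solution and crosses another one at
time `n` stays above the latter from then on. -/
theorem IsFlow.le_of_crossing (hτ : IsAction τ) (hΦ : IsFlow τ Φ C) (hlm : l ≤ m) {n Y c₂ d : ℝ}
    {ω : Ω} (hB : Φ l n (τ Y ω) (Φ l Y ω c₂) ≤ Φ m n (τ Y ω) d) {x : ℝ} (hx : Y + n ≤ x) :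
    Φ l x ω c₂ ≤ Φ m (x - Y) (τ Y ω) d := by
  have e1 : Φ m (x - Y) (τ Y ω) d = Φ m (x - Y - n) (τ (n + Y) ω) (Φ m n (τ Y ω) d) := by
    rw [hτ.add, ← hΦ.add, sub_add_cancel]
  have e2 : Φ l x ω c₂ = Φ l (x - Y - n) (τ (n + Y) ω) (Φ l n (τ Y ω) (Φ l Y ω c₂)) := by
    rw [← hΦ.add, ← hΦ.add]
    congr 1
    ring
  rw [e1, e2]
  exact (hΦ.mono _ _ _ hB).trans (hΦ.mono_level hlm (by linarith) _ _)

/-- Estimates on a primitive of a slope which switches from `φ₁` to `φ₂` on `[Y, Y + n]`. -/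
theorem primitive_bounds_of_switch {φ₁ φ₂ f : ℝ → ℝ} {I₁ I₂ R D δ θ Y n y : ℝ}
    (hφ₁ : Continuous φ₁) (hφ₂ : Continuous φ₂) (hf : Continuous f)
    (hφR : ∀ x, |φ₂ x| ≤ R) (hfR : ∀ x, |f x| ≤ R)
    (h₁ : ∀ x, |(∫ s in 0..x, φ₁ s) - x * I₁| ≤ δ * |x| + D)
    (h₂ : ∀ x, |(∫ s in 0..x, φ₂ s) - x * I₂| ≤ δ * |x| + D)
    (hI₁ : I₁ ≤ θ) (hI₂ : θ ≤ I₂) (hn : 0 ≤ n) (hθ : θ ≤ R) (hy : y ≤ Y)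
    (hl : ∀ x, x ≤ Y → f x = φ₁ x) (hr : ∀ x, Y + n ≤ x → f x = φ₂ x) :
    (∀ x, θ * x - δ * |x| - δ * |Y| - 2 * D - 2 * R * n ≤ θ * Y + ∫ s in Y..x, f s) ∧
      θ * Y + (∫ s in Y..y, f s) ≤ θ * y + 2 * R * (Y - y) := by
  have hR : 0 ≤ R := (abs_nonneg _).trans (hfR 0)
  have split : ∀ φ : ℝ → ℝ, Continuous φ → ∀ x z,
      (∫ s in x..z, φ s) = (∫ s in 0..z, φ s) - ∫ s in 0..x, φ s := fun φ hφ x z =>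
    (intervalIntegral.integral_interval_sub_left (hφ.intervalIntegrable _ _)
      (hφ.intervalIntegrable _ _)).symm
  constructor
  · intro x
    rcases le_total x Y with hx | hx
    · have e : ∫ s in Y..x, f s = ∫ s in Y..x, φ₁ s := by
        refine intervalIntegral.integral_congr fun s hs => ?_
        rw [uIcc_of_ge hx] at hs
        exact hl s hs.2
      rw [e, split φ₁ hφ₁]
      have a1 := (abs_le.1 (h₁ x)).1
      have a2 := (abs_le.1 (h₁ Y)).2
      have : (Y - x) * I₁ ≤ (Y - x) * θ := mul_le_mul_of_nonneg_left hI₁ (by linarith)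
      have : 0 ≤ 2 * R * n := by positivity
      linarith
    · have key : (∫ s in Y..x, φ₂ s) - 2 * R * n ≤ ∫ s in Y..x, f s := by
        have small : ∀ z, Y ≤ z → z ≤ Y + n →
            (∫ s in Y..z, φ₂ s) - 2 * R * n ≤ ∫ s in Y..z, f s := by
          intro z hz hzn
          have : ∫ s in Y..z, (φ₂ s - f s) ≤ ∫ s in Y..z, 2 * R := by
            refine intervalIntegral.integral_mono_on hz ((hφ₂.sub hf).intervalIntegrable _ _)
              (by simp) fun s _ => ?_
            have := (abs_le.1 (hφR s)).2
            have := (abs_le.1 (hfR s)).1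
            linarith
          rw [intervalIntegral.integral_sub (hφ₂.intervalIntegrable _ _)
            (hf.intervalIntegrable _ _), intervalIntegral.integral_const, smul_eq_mul] at this
          have : (z - Y) * (2 * R) ≤ n * (2 * R) :=
            mul_le_mul_of_nonneg_right (by linarith) (by positivity)
          linarith
        rcases le_total x (Y + n) with hxn | hxn
        · exact small x hx hxn
        · have e : ∫ s in (Y + n)..x, f s = ∫ s in (Y + n)..x, φ₂ s := by
            refine intervalIntegral.integral_congr fun s hs => ?_
            rw [uIcc_of_le hxn] at hs
            exact hr s hs.1
          have := small (Y + n) (by linarith) le_rfl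
          rw [← intervalIntegral.integral_add_adjacent_intervals (b := Y + n)
            (hf.intervalIntegrable _ _) (hf.intervalIntegrable _ _), e,
            ← intervalIntegral.integral_add_adjacent_intervals (a := Y) (b := Y + n)
            (hφ₂.intervalIntegrable _ _) (hφ₂.intervalIntegrable _ _)]
          linarith
      rw [split φ₂ hφ₂] at key
      have a1 := (abs_le.1 (h₂ x)).1
      have a2 := (abs_le.1 (h₂ Y)).2
      have : (x - Y) * θ ≤ (x - Y) * I₂ := mul_le_mul_of_nonneg_left hI₂ (by linarith)
      linarith
  · have h3 := intervalIntegral.norm_integral_le_of_norm_le_const (a := Y) (b := y) (f := f)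
      (C := R) fun s _ => hfR s
    rw [Real.norm_eq_abs, abs_sub_comm, abs_of_nonneg (sub_nonneg.2 hy)] at h3
    have := (abs_le.1 h3).2
    have : θ * (Y - y) ≤ R * (Y - y) := mul_le_mul_of_nonneg_right hθ (by linarith)
    linarith

theorem IsMedium.hasCorrectors_of_gap [IsProbabilityMeasure P] (hτ : IsErgodicAction P τ)
    (h : IsMedium τ α η K C) (hf : IsGap P τ h.flow R l f₁ f₂) (h₁ : ∫ ω, f₁ ω ∂P < θ)
    (h₂ : θ < ∫ ω, f₂ ω ∂P) (hκ : 0 < κ) :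
    ∀ᵐ ω ∂P, HasCorrectors (fun x => α (τ x ω)) (fun p x => η p (τ x ω)) R θ l κ := by
  have hΦ := h.isFlow
  have hR : 0 ≤ R := by
    obtain ⟨ω⟩ := nonempty_of_isProbabilityMeasure P
    exact (abs_nonneg _).trans (hf.left.bdd ω)
  have hθR : θ ≤ R := by
    have : ∫ ω, f₂ ω ∂P ≤ ∫ _, R ∂P :=
      integral_mono hf.right.integrable (integrable_const _) fun ω => (abs_le.1 (hf.right.bdd ω)).2
    simp at this
    linarith
  have hlm : l ≤ l + κ := by linarith
  obtain ⟨n, hn⟩ := hf.exists_crossing hτ hΦ (m := l + κ) (by linarith)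
  set B : Set Ω := {ω | h.flow l n ω (f₂ ω) < h.flow (l + κ) n ω (f₁ ω)} with hBdef
  have hB : MeasurableSet B := measurableSet_lt
    ((hΦ.meas l n).comp (measurable_id.prodMk hf.right.meas))
    ((hΦ.meas (l + κ) n).comp (measurable_id.prodMk hf.left.meas))
  have hpos : ¬ ∀ᵐ ω ∂P, ω ∉ B := by simpa [hBdef] using hn
  set r := min 1 (κ / (2 * R + 1)) with hr
  have hr0 : 0 < r := lt_min one_pos (by positivity)
  have hr1 : r ≤ 1 := min_le_left _ _
  have hr2 : 2 * R * r ≤ κ := by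
    have : r ≤ κ / (2 * R + 1) := min_le_right _ _
    rw [le_div_iff₀ (by positivity)] at this
    linarith
  filter_upwards [hf.left.ae_path hτ hΦ, hf.right.ae_path hτ hΦ, hτ.ae_exists_visit hB hpos hr0,
    hΦ.ae_le_of_integral_le hτ hf.left hf.right hf.lt.le] with ω p₁ p₂ hvis hle
  obtain ⟨ae₁, bd₁, erg₁⟩ := p₁
  obtain ⟨ae₂, bd₂, erg₂⟩ := p₂
  obtain ⟨D₁, hD₁, herg₁⟩ := erg₁ (κ / 2) (by positivity)
  obtain ⟨D₂, hD₂, herg₂⟩ := erg₂ (κ / 2) (by positivity)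
  obtain ⟨D, hD, hvis⟩ := hvis
  refine ⟨κ * D + 2 * (D₁ + D₂) + 2 * R * n + 2 * R * D, by positivity, fun y => ?_⟩
  obtain ⟨Y, hyY, hYy, hYB, hY₁, hY₂⟩ := hvis y _ (ae₁.and ae₂)
  set φ₁ := fun x => h.flow l x ω (f₁ ω) with hφ₁
  set φ₂ := fun x => h.flow l x ω (f₂ ω) with hφ₂
  set g := fun x => h.flow (l + κ) (x - Y) (τ Y ω) (f₁ (τ Y ω)) with hg
  have c₁ : Continuous φ₁ := hΦ.cont_x _ _ _
  have c₂ : Continuous φ₂ := hΦ.cont_x _ _ _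
  have cg : Continuous g := (hΦ.cont_x _ _ _).comp (continuous_id.sub continuous_const)
  have le₁₂ : ∀ x, φ₁ x ≤ φ₂ x := fun x => hΦ.mono _ _ _ hle
  have e₁ : ∀ x, h.flow l (x - Y) (τ Y ω) (f₁ (τ Y ω)) = φ₁ x := fun x => by
    rw [hY₁, hΦ.add_sub]
  set f := fun x => max (φ₁ x) (min (g x) (φ₂ x)) with hfdef
  have cf : Continuous f := c₁.max (cg.min c₂)
  have hfR : ∀ x, |f x| ≤ R := fun x => abs_le.2
    ⟨(abs_le.1 (bd₁ x)).1.trans (le_max_left _ _),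
      max_le (abs_le.1 (bd₁ x)).2 ((min_le_right _ _).trans (abs_le.1 (bd₂ x)).2)⟩
  have hl : ∀ x, x ≤ Y → f x = φ₁ x := fun x hx => max_eq_left ((min_le_left _ _).trans (by
    rw [← e₁ x]
    exact hΦ.mono_level_neg hlm (by linarith) _ _))
  have hr : ∀ x, Y + n ≤ x → f x = φ₂ x := fun x hx => by
    have : φ₂ x ≤ g x := hΦ.le_of_crossing h.toIsAction hlm (by rw [← hY₂]; exact hYB.le) hx
    simp only [hfdef, min_eq_right this, max_eq_right (le₁₂ x)]
  have s : ∀ c, IsSuperSlope (fun x => α (τ x ω)) (fun p x => η p (τ x ω)) (l + κ)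
      fun x => h.flow l x ω c := fun c => by
    have := h.isSuperSlope_flow l 0 ω c
    simp only [sub_zero, h.zero] at this
    exact this.mono_level (fun x => h.alpha_pos _) hlm
  have sf : IsSuperSlope (fun x => α (τ x ω)) (fun p x => η p (τ x ω)) (l + κ) f :=
    (s _).max c₁ (cg.min c₂) ((h.isSuperSlope_flow (l + κ) Y ω _).min cg c₂ (s _))
  obtain ⟨b₁, b₂⟩ := primitive_bounds_of_switch (δ := κ / 2) (D := D₁ + D₂) c₁ c₂ cf bd₂ hfR
    (fun x => (herg₁ x).trans (by linarith)) (fun x => (herg₂ x).trans (by linarith))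
    h₁.le h₂.le (Nat.cast_nonneg n) hθR hyY hl hr
  refine ⟨f, fun x => θ * Y + ∫ s in Y..x, f s, fun x => ?_, hfR, sf, fun x => ?_, ?_⟩
  · simpa using ((cf.integral_hasStrictDerivAt Y x).hasDerivAt).const_add (θ * Y)
  · refine le_trans ?_ (b₁ x)
    have hYabs : |Y| ≤ 2 * |y| + D := by
      have := neg_abs_le y
      have := le_abs_self y
      have : r * |y| ≤ 1 * |y| := by gcongr
      rw [abs_le]
      constructor <;> linarith [abs_nonneg y]
    have : κ / 2 * |Y| ≤ κ / 2 * (2 * |y| + D) := by gcongr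
    have : 0 ≤ κ * |x| := by positivity
    have : 0 ≤ κ * D := by positivity
    have : 0 ≤ 2 * R * D := by positivity
    linarith
  · have a1 : 2 * R * (Y - y) ≤ 2 * R * (r * |y| + D) :=
      mul_le_mul_of_nonneg_left (by linarith) (by positivity)
    have a2 : 2 * R * r * |y| ≤ κ * |y| := mul_le_mul_of_nonneg_right hr2 (abs_nonneg _)
    have : 0 ≤ κ * D := by positivity
    have : 0 ≤ 2 * R * n := by positivity
    linarith

theorem IsMedium.ae_forall_hasCorrectors (h : IsMedium τ α η K C)
    (H : ∀ κ > 0, ∀ᵐ ω ∂P,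
      HasCorrectors (fun x => α (τ x ω)) (fun p x => η p (τ x ω)) R θ l κ) :
    ∀ᵐ ω ∂P, ∀ κ > 0,
      HasCorrectors (fun x => α (τ x ω)) (fun p x => η p (τ x ω)) R θ l κ := by
  have : ∀ᵐ ω ∂P, ∀ n : ℕ,
      HasCorrectors (fun x => α (τ x ω)) (fun p x => η p (τ x ω)) R θ l (1 / (n + 1 : ℝ)) :=
    ae_all_iff.2 fun n => H _ (by positivity)
  filter_upwards [this] with ω hω κ hκ
  obtain ⟨n, hn⟩ := exists_nat_one_div_lt hκ
  exact (hω n).mono (fun x => h.alpha_pos _) hn.le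

/-- Between the means of two stationary solutions, every slope has a level at which there are
approximate correctors both for the equation and for the reflected one. -/
theorem IsMedium.exists_level [IsProbabilityMeasure P] (hτ : IsErgodicAction P τ)
    (h : IsMedium τ α η K C) (hf : IsStat P τ h.flow R l f₁) (hg : IsStat P τ h.flow R m f₂)
    (hfθ : ∫ ω, f₁ ω ∂P ≤ θ) (hgθ : θ ≤ ∫ ω, f₂ ω ∂P) :
    ∃ k, (∀ᵐ ω ∂P, ∀ κ > 0,
        HasCorrectors (fun x => α (τ x ω)) (fun p x => η p (τ x ω)) R θ k κ) ∧
      ∀ᵐ ω ∂P, ∀ κ > 0,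
        HasCorrectors (fun x => α (τ x ω)) (fun p x => -η (-p) (τ x ω)) R (-θ) (-k) κ := by
  obtain ⟨k, ⟨φ, hφ, hφθ⟩ | ⟨φ₁, φ₂, hgap, h₁, h₂⟩⟩ := h.isFlow.stat_or_gap hτ hf hg hfθ hgθ
  · refine ⟨k, h.ae_forall_hasCorrectors fun κ hκ => ?_,
      h.neg.ae_forall_hasCorrectors fun κ hκ => ?_⟩
    · rw [← hφθ]
      exact h.hasCorrectors_of_stat hτ hφ hκ
    · have := hφ.neg
      rw [← h.flow_neg] at this
      have := h.neg.hasCorrectors_of_stat hτ this hκ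
      rwa [integral_neg, hφθ] at this
  · refine ⟨k, h.ae_forall_hasCorrectors fun κ hκ => h.hasCorrectors_of_gap hτ hgap h₁ h₂ hκ,
      h.neg.ae_forall_hasCorrectors fun κ hκ => ?_⟩
    have := hgap.neg
    rw [← h.flow_neg] at this
    exact h.neg.hasCorrectors_of_gap hτ this (by rw [integral_neg]; linarith)
      (by rw [integral_neg]; linarith) hκ

end Gap

section Barrier

variable {Ω : Type*} [MeasurableSpace Ω] {τ : ℝ → Ω → Ω} {α : Ω → ℝ}
  {η : ℝ → Ω → ℝ} {K : NNReal} {C l c : ℝ}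

theorem IsMedium.le_flow_of_lt (h : IsMedium τ α η K C) (hc : ∀ ω, η c ω < l) (x : ℝ) (ω : Ω)
    (hx : 0 ≤ x) : c ≤ h.flow l x ω c := by
  refine image_le_of_deriv_right_lt_deriv_boundary' (f := fun _ => c) (f' := fun _ => 0)
    (B := fun x => h.flow l x ω c) (B' := fun x => drift τ α η l ω x (h.flow l x ω c))
    (a := 0) (b := x) continuousOn_const (fun _ _ => hasDerivWithinAt_const _ _ _)
    (by simp [h.flow_zero]) (h.isFlow.cont_x l ω c).continuousOn
    (fun y _ => (h.flow_isGlobalSol l ω c y).hasDerivWithinAt) (fun y _ hy => ?_) ⟨hx, le_rfl⟩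
  rw [← hy]
  exact div_pos (sub_pos.2 (hc _)) (h.alpha_pos _)

theorem IsMedium.flow_le_of_lt (h : IsMedium τ α η K C) (hc : ∀ ω, l < η c ω) (x : ℝ) (ω : Ω)
    (hx : 0 ≤ x) : h.flow l x ω c ≤ c := by
  refine image_le_of_deriv_right_lt_deriv_boundary' (B := fun _ => c) (B' := fun _ => 0)
    (f := fun x => h.flow l x ω c) (f' := fun x => drift τ α η l ω x (h.flow l x ω c))
    (a := 0) (b := x) (h.isFlow.cont_x l ω c).continuousOn
    (fun y _ => (h.flow_isGlobalSol l ω c y).hasDerivWithinAt)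
    (by simp [h.flow_zero]) continuousOn_const (fun _ _ => hasDerivWithinAt_const _ _ _)
    (fun y _ hy => ?_) ⟨hx, le_rfl⟩
  rw [hy]
  exact div_neg_of_neg_of_pos (sub_neg.2 (hc _)) (h.alpha_pos _)

end Barrier

section Model

variable {Ω : Type} [MeasurableSpace Ω] {P : Measure Ω} {τ : ℝ → Ω → Ω}
  {a : ℝ → Ω → ℝ} {H : ℝ → ℝ → Ω → ℝ} {G_L G_U : ℝ → ℝ}

theorem HJSetting.isErgodicAction (h : HJSetting P τ a H G_L G_U) : IsErgodicAction P τ where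
  meas := h.meas_tau
  zero := h.tau_zero
  add := h.tau_add
  mp := h.mp_tau
  ergodic := h.ergodic

theorem HJSetting.continuous_a (h : HJSetting P τ a H G_L G_U) (ω : Ω) :
    Continuous fun x => a x ω := by
  obtain ⟨κ, hκ, hlip⟩ := h.a_sqrt_lip
  have hs : LipschitzWith κ.toNNReal fun x => √(a x ω) := by
    refine LipschitzWith.of_dist_le_mul fun x y => ?_
    have := hlip (x - y) (τ y ω)
    rw [h.a_stat (x - y), ← h.tau_add, sub_add_cancel, ← h.a_stat, ← h.a_stat] at this
    rwa [Real.coe_toNNReal _ hκ.le, Real.dist_eq, Real.dist_eq]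
  have : (fun x => a x ω) = fun x => √(a x ω) ^ 2 := by
    funext x
    rw [Real.sq_sqrt (h.a_pos x ω).le]
  rw [this]
  exact hs.continuous.pow 2

theorem HJSetting.continuous_H (h : HJSetting P τ a H G_L G_U) (p : ℝ) (ω : Ω) :
    Continuous fun x => H p x ω := by
  obtain ⟨m, hm0, -, hm, hH⟩ := h.H_mod (|p| + 1) (by positivity)
  rw [Metric.continuous_iff]
  intro x₀ ε hε
  obtain ⟨δ, hδ, hmδ⟩ := (Metric.tendsto_nhdsWithin_nhds.1 hm) ε hε
  refine ⟨δ, hδ, fun x hx => ?_⟩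
  rcases eq_or_ne x x₀ with rfl | hne
  · simpa using hε
  have h1 := hH p (x - x₀) (τ x₀ ω) (by linarith)
  rw [h.H_stat p (x - x₀), ← h.tau_add, sub_add_cancel, ← h.H_stat, ← h.H_stat] at h1
  have h2 := hmδ (x := |x - x₀|) (abs_pos.2 (sub_ne_zero.2 hne)) (by
    rwa [Real.dist_eq, sub_zero, abs_abs, ← Real.dist_eq])
  rw [Real.dist_eq, sub_zero, abs_of_nonneg (hm0 _)] at h2
  rw [Real.dist_eq]
  linarith

theorem abs_max_min_le {R : ℝ} (hR : 0 ≤ R) (p : ℝ) : |max (-R) (min R p)| ≤ R :=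
  abs_le.2 ⟨le_max_left _ _, max_le (by linarith) (min_le_left _ _)⟩

theorem max_min_eq_self {R p : ℝ} (hp : |p| ≤ R) : max (-R) (min R p) = p := by
  rw [min_eq_right (abs_le.1 hp).2, max_eq_right (abs_le.1 hp).1]

theorem HJSetting.GL_le (h : HJSetting P τ a H G_L G_U) {p q : ℝ} (hpq : |p| ≤ |q|) :
    G_L p ≤ G_L q := by
  have e : ∀ r, G_L |r| = G_L r := fun r => by
    rcases abs_choice r with hr | hr <;> rw [hr]
    exact h.GL_even r
  rw [← e p, ← e q]
  exact h.GL_mono (abs_nonneg p) (abs_nonneg q) hpq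

theorem HJSetting.GU_le (h : HJSetting P τ a H G_L G_U) {p q : ℝ} (hpq : |p| ≤ |q|) :
    G_U p ≤ G_U q := by
  have e : ∀ r, G_U |r| = G_U r := fun r => by
    rcases abs_choice r with hr | hr <;> rw [hr]
    exact h.GU_even r
  rw [← e p, ← e q]
  exact h.GU_mono (abs_nonneg p) (abs_nonneg q) hpq

/-- Truncating the momentum variable yields a medium. -/
theorem HJSetting.exists_isMedium (h : HJSetting P τ a H G_L G_U) {R : ℝ} (hR : 0 < R) :
    ∃ K C, IsMedium τ (a 0) (fun p ω => H (max (-R) (min R p)) 0 ω) K C := by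
  obtain ⟨K, hK, hlip⟩ := h.H_lip R hR
  have bd := fun p => abs_max_min_le hR.le p
  refine ⟨K.toNNReal, max |G_L 0| |G_U R|, ?_⟩
  exact
    { toIsAction := h.isErgodicAction.toIsAction
      alpha_meas := h.meas_a.comp (measurable_const.prodMk measurable_id)
      alpha_pos := h.a_pos 0
      alpha_cont := fun ω => by
        simp only [← h.a_stat]
        exact h.continuous_a ω
      eta_meas := fun p => h.meas_H.comp
        (measurable_const.prodMk (measurable_const.prodMk measurable_id))
      eta_lip := fun ω => by
        refine LipschitzWith.of_dist_le_mul fun p q => ?_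
        rw [Real.coe_toNNReal _ hK.le, Real.dist_eq, Real.dist_eq]
        refine (hlip _ _ ω (bd p) (bd q)).trans (mul_le_mul_of_nonneg_left ?_ hK.le)
        exact (abs_max_sub_max_le_max _ _ _ _).trans (by
          simpa using! (abs_min_sub_min_le_max R p R q))
      eta_bdd := fun p ω => by
        have h1 := h.H_lower (max (-R) (min R p)) ω
        have h2 := h.H_upper (max (-R) (min R p)) ω
        have h3 : G_L 0 ≤ G_L (max (-R) (min R p)) := h.GL_le (by simp)
        have h4 : G_U (max (-R) (min R p)) ≤ G_U R :=
          h.GU_le ((bd p).trans (le_abs_self R))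
        have h5 := neg_abs_le (G_L 0)
        have h6 := le_abs_self (G_U R)
        have h7 := le_max_left |G_L 0| |G_U R|
        have h8 := le_max_right |G_L 0| |G_U R|
        exact abs_le.2 ⟨by linarith, by linarith⟩
      eta_cont := fun p ω => by
        simp only [← h.H_stat]
        exact h.continuous_H _ ω }

/-- For all slopes in a bounded range there are levels with approximate correctors, both for the
equation and for the reflected one. -/
theorem HJSetting.exists_level (h : HJSetting P τ a H G_L G_U) {M : ℝ} (hM : 0 < M) :
    ∃ R, M < R ∧ ∀ θ, |θ| ≤ M → ∃ k, (∀ᵐ ω ∂P, ∀ κ > 0,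
        HasCorrectors (fun x => a x ω) (fun p x => H p x ω) R θ k κ) ∧
      ∀ᵐ ω ∂P, ∀ κ > 0,
        HasCorrectors (fun x => a x ω) (fun p x => -H (-p) x ω) R (-θ) (-k) κ := by
  have := h.prob
  have hτ := h.isErgodicAction
  set l := G_U M + 1 with hl
  obtain ⟨R, hR, hRM⟩ := ((h.GL_coercive.eventually_gt_atTop l).and
    (eventually_gt_atTop M)).exists
  have hR0 : 0 < R := hM.trans hRM
  obtain ⟨K, C, hm⟩ := h.exists_isMedium hR0
  have low : ∀ p, |p| = M → ∀ ω, H (max (-R) (min R p)) 0 ω < l := fun p hp ω => by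
    rw [max_min_eq_self (by linarith)]
    have := h.H_upper p ω
    have : G_U p ≤ G_U M := h.GU_le (by rw [hp]; exact le_abs_self M)
    linarith
  have high : ∀ p, |p| = R → ∀ ω, l < H (max (-R) (min R p)) 0 ω := fun p hp ω => by
    rw [max_min_eq_self hp.le]
    have := h.H_lower p ω
    have : G_L R ≤ G_L p := h.GL_le (by rw [hp, abs_of_pos hR0])
    linarith
  obtain ⟨g, hg, hgM⟩ := hm.isFlow.exists_stat_of_barriers (l := l) hτ hM.le hRM.le
    (hm.le_flow_of_lt (low M (abs_of_pos hM))) (hm.flow_le_of_lt (high R (abs_of_pos hR0)))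
  obtain ⟨f, hf, hfM⟩ := hm.isFlow.exists_stat_of_neg_barriers (l := l) hτ hM.le hRM.le
    (hm.le_flow_of_lt (low (-M) (by rw [abs_neg, abs_of_pos hM])))
    (hm.flow_le_of_lt (high (-R) (by rw [abs_neg, abs_of_pos hR0])))
  refine ⟨R, hRM, fun θ hθ => ?_⟩
  obtain ⟨k, h1, h2⟩ := hm.exists_level (θ := θ) hτ hf hg (by linarith [(abs_le.1 hθ).1])
    (by linarith [(abs_le.1 hθ).2])
  refine ⟨k, ?_, ?_⟩
  · filter_upwards [h1] with ω hω κ hκ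
    have := (hω κ hκ).congr (h' := fun p x => H p x ω) fun p x hp => by
      rw [max_min_eq_self hp, ← h.H_stat]
    simpa only [← h.a_stat] using this
  · filter_upwards [h2] with ω hω κ hκ
    have := (hω κ hκ).congr (h' := fun p x => -H (-p) x ω) fun p x hp => by
      rw [max_min_eq_self (by rwa [abs_neg]), ← h.H_stat]
    simpa only [← h.a_stat] using this

end Model

section Comparison

variable {α : ℝ → ℝ} {h : ℝ → ℝ → ℝ} {v : ℝ → ℝ → ℝ} {f F : ℝ → ℝ} {R L K l k θ θ' κ β C : ℝ}

theorem IsViscositySupersolution.neg (hv : IsViscositySupersolution α h v) :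
    IsViscositySubsolution α (fun p x => -h (-p) x) fun t x => -v t x := by
  intro t₀ x₀ ht φ hφ hmax
  have hmin : IsLocalMin (fun q : ℝ × ℝ => v q.1 q.2 - (-φ q)) (t₀, x₀) := by
    have := hmax.neg
    refine this.congr (Eventually.of_forall fun q => ?_)
    simp only
    ring
  have := hv t₀ x₀ ht (fun q => -φ q) hφ.neg hmin
  simp only [deriv.fun_neg'] at this
  linarith

/-- Uniformly continuous functions on the half plane grow at most linearly in time. -/
theorem UniformContinuousOn.exists_le_add_mul
    (hv : UniformContinuousOn (fun q : ℝ × ℝ => v q.1 q.2) {q : ℝ × ℝ | 0 ≤ q.1}) :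
    ∃ D, 0 ≤ D ∧ ∀ t x, 0 ≤ t → v t x ≤ v 0 x + 1 + D * t := by
  obtain ⟨δ, hδ, H⟩ := Metric.uniformContinuousOn_iff.1 hv 1 one_pos
  have step : ∀ n : ℕ, ∀ t x, 0 ≤ t → t ≤ n * (δ / 2) → v t x ≤ v 0 x + n := by
    intro n
    induction n with
    | zero =>
      intro t x h0 h1
      have : t = 0 := by
        norm_num at h1
        linarith
      simp [this]
    | succ n ih =>
      intro t x h0 h1
      push_cast at h1 ⊢
      rcases le_total t (n * (δ / 2)) with h2 | h2
      · linarith [ih t x h0 h2]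
      · have h3 := ih (n * (δ / 2)) x (by positivity) le_rfl
        have h4 := H (t, x) h0 (n * (δ / 2), x) (by show (0 : ℝ) ≤ _; positivity) (by
          rw [Prod.dist_eq, dist_self, max_eq_left dist_nonneg, Real.dist_eq,
            abs_of_nonneg (by linarith)]
          linarith)
        rw [Real.dist_eq] at h4
        linarith [(abs_lt.1 h4).2]
  refine ⟨2 / δ, by positivity, fun t x ht => ?_⟩
  have h1 := step ⌈t / (δ / 2)⌉₊ t x ht (by
    rw [← div_le_iff₀ (by positivity)]
    exact Nat.le_ceil _)
  have h2 := Nat.ceil_lt_add_one (a := t / (δ / 2)) (by positivity)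
  have h3 : t / (δ / 2) = 2 / δ * t := by field_simp
  linarith

theorem IsSuperSlope.eventually_le {x₀ s : ℝ} (hF : ∀ x, HasDerivAt F (f x) x)
    (hf : IsSuperSlope α h l f) (hs : (l - h (f x₀) x₀) / α x₀ < s) :
    ∀ᶠ x in nhds x₀, F x ≤ F x₀ + f x₀ * (x - x₀) + s / 2 * (x - x₀) ^ 2 := by
  obtain ⟨ε, hε, hball⟩ := Metric.eventually_nhds_iff_ball.1 (hf x₀ s hs)
  refine Metric.eventually_nhds_iff_ball.2 ⟨ε, hε, fun x hx => ?_⟩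
  set D : ℝ → ℝ := fun x => F x₀ + f x₀ * (x - x₀) + s / 2 * (x - x₀) ^ 2 - F x with hD
  have hd : ∀ z, HasDerivAt D (f x₀ + s * (z - x₀) - f z) z := fun z => by
    have h1 := ((hasDerivAt_id z).sub_const x₀)
    have := (((h1.const_mul (f x₀)).const_add (F x₀)).add ((h1.pow 2).const_mul (s / 2))).sub
      (hF z)
    convert! this using 1
    simp
    ring
  have hc : Continuous D := continuous_iff_continuousAt.2 fun z => (hd z).continuousAt
  have key : D x₀ ≤ D x := by
    rw [Metric.mem_ball, Real.dist_eq] at hx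
    rcases lt_trichotomy x x₀ with hlt | rfl | hlt
    · obtain ⟨ξ, hξ, he⟩ := exists_hasDerivAt_eq_slope D _ hlt hc.continuousOn fun z _ => hd z
      have hb := hball ξ (by
        rw [abs_of_neg (by linarith)] at hx
        rw [Metric.mem_ball, Real.dist_eq, abs_of_neg (by linarith [hξ.2])]
        linarith [hξ.1])
      rw [eq_div_iff (by linarith)] at he
      have : f x₀ + s * (ξ - x₀) - f ξ ≤ 0 := by
        by_contra hcon
        have := mul_neg_of_pos_of_neg (not_le.1 hcon) (sub_neg.2 hξ.2)
        linarith
      have := mul_nonpos_of_nonpos_of_nonneg this (sub_pos.2 hlt).le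
      linarith
    · exact le_rfl
    · obtain ⟨ξ, hξ, he⟩ := exists_hasDerivAt_eq_slope D _ hlt hc.continuousOn fun z _ => hd z
      have hb := hball ξ (by
        rw [abs_of_pos (by linarith)] at hx
        rw [Metric.mem_ball, Real.dist_eq, abs_of_pos (by linarith [hξ.1])]
        linarith [hξ.2])
      rw [eq_div_iff (by linarith)] at he
      have : 0 ≤ f x₀ + s * (ξ - x₀) - f ξ := by
        by_contra hcon
        have := mul_neg_of_neg_of_pos (not_le.1 hcon) (sub_pos.2 hξ.1)
        linarith
      have := mul_nonneg this (sub_pos.2 hlt).le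
      linarith
  simp only [hD, sub_self] at key
  linarith

theorem sqrt_one_add_sq_le (x₀ x : ℝ) :
    √(1 + x ^ 2) ≤ √(1 + x₀ ^ 2) + x₀ / √(1 + x₀ ^ 2) * (x - x₀) + 1 / 2 * (x - x₀) ^ 2 := by
  set A := √(1 + x₀ ^ 2) with hA
  have hA2 : A ^ 2 = 1 + x₀ ^ 2 := Real.sq_sqrt (by positivity)
  have hA1 : 1 ≤ A := Real.one_le_sqrt.2 (by nlinarith [sq_nonneg x₀])
  have hA0 : 0 < A := by linarith
  set B := √(1 + x ^ 2) with hB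
  have hB2 : B ^ 2 = 1 + x ^ 2 := Real.sq_sqrt (by positivity)
  have h1 : B * A ≤ A ^ 2 + x₀ * (x - x₀) + 1 / 2 * (x - x₀) ^ 2 := by
    nlinarith [sq_nonneg (A - B)]
  have h2 : 1 / 2 * (x - x₀) ^ 2 ≤ A * (1 / 2 * (x - x₀) ^ 2) :=
    le_mul_of_one_le_left (by positivity) hA1
  have h3 : x₀ / A * (x - x₀) * A = x₀ * (x - x₀) := by field_simp
  have h4 : B * A ≤ (A + x₀ / A * (x - x₀) + 1 / 2 * (x - x₀) ^ 2) * A := by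
    rw [add_mul, add_mul, h3]
    linarith
  exact le_of_mul_le_mul_right h4 hA0

theorem abs_div_sqrt_one_add_sq_le (x : ℝ) : |x / √(1 + x ^ 2)| ≤ 1 := by
  have h0 : 0 < √(1 + x ^ 2) := Real.sqrt_pos.2 (by positivity)
  rw [abs_div, abs_of_pos h0, div_le_one h0]
  exact Real.abs_le_sqrt (by linarith)

/-- Testing a viscosity subsolution with a quadratic polynomial. -/
theorem IsViscositySubsolution.quadratic_test (hv : IsViscositySubsolution α h v) {t₀ x₀ p q c σ : ℝ}
    (ht : 0 < t₀) (hmax : IsLocalMax (fun z : ℝ × ℝ => v z.1 z.2 -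
      (p * (z.2 - x₀) + q / 2 * (z.2 - x₀) ^ 2 + (c * z.1 + σ * z.1 ^ 2))) (t₀, x₀)) :
    c + 2 * σ * t₀ ≤ α x₀ * q + h p x₀ := by
  have key := hv t₀ x₀ ht (fun z => p * (z.2 - x₀) + q / 2 * (z.2 - x₀) ^ 2 +
    (c * z.1 + σ * z.1 ^ 2)) (by fun_prop) hmax
  have d1 : deriv (fun t : ℝ => p * (x₀ - x₀) + q / 2 * (x₀ - x₀) ^ 2 + (c * t + σ * t ^ 2)) t₀ =
      c + 2 * σ * t₀ := by
    have h1 := hasDerivAt_id t₀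
    have := ((h1.const_mul c).add ((h1.pow 2).const_mul σ)).const_add
      (p * (x₀ - x₀) + q / 2 * (x₀ - x₀) ^ 2)
    refine HasDerivAt.deriv ?_
    convert! this using 1
    simp
    ring
  have d2 : (deriv fun x : ℝ => p * (x - x₀) + q / 2 * (x - x₀) ^ 2 + (c * t₀ + σ * t₀ ^ 2)) =
      fun x => p + q * (x - x₀) := by
    funext x
    have h1 := (hasDerivAt_id x).sub_const x₀
    have := ((h1.const_mul p).add ((h1.pow 2).const_mul (q / 2))).add_const
      (c * t₀ + σ * t₀ ^ 2)
    refine HasDerivAt.deriv ?_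
    convert! this using 1
    simp
    ring
  have d3 : deriv (fun x : ℝ => p + q * (x - x₀)) x₀ = q := by
    have := (((hasDerivAt_id x₀).sub_const x₀).const_mul q).const_add p
    refine HasDerivAt.deriv ?_
    convert! this using 1
    simp
  simp only [d1, d2, d3] at key
  simpa using key

/-- Comparison with the evolution of a stationary supersolution. -/
theorem IsViscositySubsolution.le_of_superSlope (hα0 : ∀ x, 0 < α x) (hα1 : ∀ x, α x ≤ 1)
    (hv : IsViscositySubsolution α h v)
    (huc : UniformContinuousOn (fun q : ℝ × ℝ => v q.1 q.2) {q : ℝ × ℝ | 0 ≤ q.1})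
    (hinit : ∀ x, v 0 x = θ * x)
    (hlip : ∀ p q x, |p| ≤ L → |q| ≤ L → |h p x - h q x| ≤ K * |p - q|) (hK : 0 ≤ K)
    (hF : ∀ x, HasDerivAt F (f x) x) (hfR : ∀ x, |f x| ≤ R) (hf : IsSuperSlope α h l f)
    (hlow : ∀ x, θ * x - β * |x| - C ≤ F x) (hβ : 0 < β) (hR : R + 2 * β ≤ L) {t x : ℝ}
    (ht : 0 ≤ t) :
    v t x ≤ F x + 2 * β * √(1 + x ^ 2) + C + (l + 2 * β * (1 + K)) * t := by
  set c := l + 2 * β * (1 + K) with hc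
  suffices H : ∀ σ > 0, v t x - F x - 2 * β * √(1 + x ^ 2) - C - c * t - σ * t ^ 2 ≤ 0 by
    refine le_of_forall_pos_le_add fun ε hε => ?_
    have h1 := H (ε / (t ^ 2 + 1)) (by positivity)
    have h2 : ε / (t ^ 2 + 1) * t ^ 2 ≤ ε := by
      rw [div_mul_eq_mul_div, div_le_iff₀ (by positivity)]
      nlinarith
    linarith
  intro σ hσ
  by_contra hcon
  obtain ⟨D, hD, hgrow⟩ := huc.exists_le_add_mul
  set Ψ : ℝ × ℝ → ℝ := fun z =>
    v z.1 z.2 - F z.2 - 2 * β * √(1 + z.2 ^ 2) - C - c * z.1 - σ * z.1 ^ 2 with hΨ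
  have hcF : Continuous F := continuous_iff_continuousAt.2 fun z => (hF z).continuousAt
  have hcΨ : ContinuousOn Ψ {q : ℝ × ℝ | 0 ≤ q.1} := by
    have h1 : Continuous fun z : ℝ × ℝ => F z.2 := hcF.comp continuous_snd
    have h2 : Continuous fun z : ℝ × ℝ => 2 * β * √(1 + z.2 ^ 2) := by fun_prop
    have h3 : Continuous fun z : ℝ × ℝ => c * z.1 := by fun_prop
    have h4 : Continuous fun z : ℝ × ℝ => σ * z.1 ^ 2 := by fun_prop
    exact ((((huc.continuousOn.sub h1.continuousOn).sub h2.continuousOn).sub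
      continuousOn_const).sub h3.continuousOn).sub h4.continuousOn
  have bound : ∀ z : ℝ × ℝ, 0 ≤ z.1 → Ψ z ≤ 1 + (D - c) * z.1 - β * |z.2| - σ * z.1 ^ 2 := by
    intro z hz
    have h1 := hgrow z.1 z.2 hz
    rw [hinit] at h1
    have h2 := hlow z.2
    have h3 : |z.2| ≤ √(1 + z.2 ^ 2) := Real.abs_le_sqrt (by linarith)
    have h4 : 2 * β * |z.2| ≤ 2 * β * √(1 + z.2 ^ 2) := by gcongr
    simp only [hΨ]
    linarith
  have h0 : ∀ y, Ψ (0, y) ≤ 0 := by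
    intro y
    have h2 := hlow y
    have h3 : |y| ≤ √(1 + y ^ 2) := Real.abs_le_sqrt (by linarith)
    have h4 : 2 * β * |y| ≤ 2 * β * √(1 + y ^ 2) := by gcongr
    have h5 : 0 ≤ β * |y| := by positivity
    simp only [hΨ, hinit]
    linarith
  set N := |D - c| + 1 with hN
  have hN0 : 0 < N := by positivity
  set T := N / σ + 1 with hT
  set X := (1 + N * T) / β with hX
  have hT0 : 0 < T := by positivity
  have hpos : 0 < Ψ (t, x) := not_le.1 hcon
  have out : ∀ z : ℝ × ℝ, 0 ≤ z.1 → 0 < Ψ z → z ∈ Icc (0 : ℝ) T ×ˢ Icc (-X) X := by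
    intro z hz hzp
    have hb := bound z hz
    have e1 : (D - c) * z.1 ≤ |D - c| * z.1 := mul_le_mul_of_nonneg_right (le_abs_self _) hz
    have hβz : 0 ≤ β * |z.2| := by positivity
    have hzT : z.1 ≤ T := by
      by_contra hgt
      have h1 : σ * T < σ * z.1 := mul_lt_mul_of_pos_left (not_le.1 hgt) hσ
      have h2 : σ * T = N + σ := by rw [hT]; field_simp
      have h3 : 1 ≤ T := by rw [hT]; linarith [div_pos hN0 hσ]
      have h4 : 0 ≤ (σ * z.1 - (N + σ)) * z.1 := mul_nonneg (by linarith) hz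
      have h5 : 0 ≤ σ * z.1 := by positivity
      have h6 : N * z.1 = |D - c| * z.1 + z.1 := by rw [hN]; ring
      have h7 := not_le.1 hgt
      nlinarith
    refine ⟨⟨hz, hzT⟩, abs_le.1 ?_⟩
    rw [hX, le_div_iff₀ hβ]
    have h1 : |D - c| * z.1 ≤ |D - c| * T := by gcongr
    have h2 : 0 ≤ σ * z.1 ^ 2 := by positivity
    linarith
  have hcomp : IsCompact (Icc (0 : ℝ) T ×ˢ Icc (-X) X) := isCompact_Icc.prod isCompact_Icc
  obtain ⟨z₀, hz₀, hzmax⟩ := hcomp.exists_isMaxOn ⟨_, out (t, x) ht hpos⟩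
    (hcΨ.mono fun z hz => hz.1.1)
  have hz₀pos : 0 < Ψ z₀ := hpos.trans_le (hzmax (out (t, x) ht hpos))
  have hglob : ∀ z : ℝ × ℝ, 0 ≤ z.1 → Ψ z ≤ Ψ z₀ := fun z hz => by
    by_cases hp : 0 < Ψ z
    · exact hzmax (out z hz hp)
    · linarith [not_lt.1 hp]
  obtain ⟨t₀, x₀⟩ := z₀
  have ht₀ : 0 < t₀ := by
    rcases (show (0 : ℝ) ≤ t₀ from hz₀.1.1).eq_or_lt with he | hlt
    · rw [← he] at hz₀pos
      linarith [h0 x₀]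
    · exact hlt
  set s := (l - h (f x₀) x₀) / α x₀ + σ * t₀ with hs
  set w := x₀ / √(1 + x₀ ^ 2) with hw
  have hw1 : |w| ≤ 1 := abs_div_sqrt_one_add_sq_le x₀
  have test := hv.quadratic_test (x₀ := x₀) (p := f x₀ + 2 * β * w) (q := s + 2 * β) (c := c)
    (σ := σ) ht₀ (by
      have e1 : ∀ᶠ z : ℝ × ℝ in nhds (t₀, x₀), 0 < z.1 :=
        continuous_fst.continuousAt.eventually_const_lt ht₀
      have e2 : ∀ᶠ z : ℝ × ℝ in nhds (t₀, x₀),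
          F z.2 ≤ F x₀ + f x₀ * (z.2 - x₀) + s / 2 * (z.2 - x₀) ^ 2 :=
        continuous_snd.continuousAt.eventually
          (hf.eventually_le (s := s) hF (by rw [hs]; linarith [mul_pos hσ ht₀]))
      filter_upwards [e1, e2] with z hz1 hz2
      have g1 := hglob z hz1.le
      have g2 := mul_le_mul_of_nonneg_left (sqrt_one_add_sq_le x₀ z.2) (by positivity : 0 ≤ 2 * β)
      rw [← hw] at g2
      simp only [hΨ] at g1
      simp only [sub_self]
      linarith)
  have hαx := hα0 x₀
  have a1 : α x₀ * s = l - h (f x₀) x₀ + α x₀ * (σ * t₀) := by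
    rw [hs]; field_simp
  have a2 : α x₀ * (σ * t₀) ≤ 1 * (σ * t₀) := by
    have := hα1 x₀
    gcongr
  have a3 : α x₀ * (2 * β) ≤ 1 * (2 * β) := by
    have := hα1 x₀
    gcongr
  have hwβ : |2 * β * w| ≤ 2 * β := by
    rw [abs_mul, abs_of_pos (by positivity : 0 < 2 * β)]
    exact mul_le_of_le_one_right (by positivity) hw1
  have a4 := (abs_le.1 (hlip (f x₀ + 2 * β * w) (f x₀) x₀
    ((abs_add_le _ _).trans (by linarith [hfR x₀])) (by linarith [hfR x₀]))).2
  rw [add_sub_cancel_left] at a4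
  have a5 : K * |2 * β * w| ≤ K * (2 * β) := by gcongr
  have a6 := mul_pos hσ ht₀
  linarith

theorem IsViscositySubsolution.le_of_hasCorrectors (hα0 : ∀ x, 0 < α x) (hα1 : ∀ x, α x ≤ 1)
    (hv : IsViscositySubsolution α h v)
    (huc : UniformContinuousOn (fun q : ℝ × ℝ => v q.1 q.2) {q : ℝ × ℝ | 0 ≤ q.1})
    (hinit : ∀ x, v 0 x = θ' * x)
    (hlip : ∀ p q x, |p| ≤ L → |q| ≤ L → |h p x - h q x| ≤ K * |p - q|) (hK : 0 ≤ K)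
    (hc : HasCorrectors α h R θ k κ) (hκ : 0 < κ) (hβ : κ + |θ - θ'| ≤ β) (hR : R + 2 * β ≤ L) :
    ∃ D, 0 ≤ D ∧ ∀ t y, 0 ≤ t →
      v t y ≤ θ' * y + k * t + β * ((5 + 2 * K) * (|y| + t)) + D := by
  obtain ⟨C, hC, H⟩ := hc
  have hd := abs_nonneg (θ - θ')
  have hβ0 : 0 < β := by linarith
  refine ⟨2 * C + 2 * β, by positivity, fun t y ht => ?_⟩
  obtain ⟨f, F, hF, hfR, hf, hlow, hup⟩ := H y
  have hy := abs_nonneg y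
  have diff : ∀ x, |θ * x - θ' * x| ≤ (β - κ) * |x| := fun x => by
    rw [← sub_mul, abs_mul]
    exact mul_le_mul_of_nonneg_right (by linarith) (abs_nonneg x)
  have main := hv.le_of_superSlope (β := β) (C := κ * |y| + C) (t := t) (x := y) hα0 hα1 huc hinit
    hlip hK hF hfR hf
    (fun x => by
      have := (abs_le.1 (diff x)).1
      linarith [hlow x]) hβ0 hR ht
  have e1 : √(1 + y ^ 2) ≤ 1 + |y| := Real.sqrt_le_iff.2 ⟨by positivity, by
    nlinarith [sq_abs y]⟩
  have e2 : 2 * β * √(1 + y ^ 2) ≤ 2 * β * (1 + |y|) := by gcongr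
  have e3 := (abs_le.1 (diff y)).2
  have e4 : κ * |y| ≤ β * |y| := mul_le_mul_of_nonneg_right (by linarith) hy
  have e5 : κ * t ≤ β * t := mul_le_mul_of_nonneg_right (by linarith) ht
  have e6 : 0 ≤ β * (K * |y|) := by positivity
  have e7 : 0 ≤ β * t := by positivity
  have e8 : 0 ≤ β * |y| := by positivity
  linarith

theorem hasCorrectors_linear (hα : ∀ x, 0 < α x) (hl : ∀ x, h θ x ≤ l) (hκ : 0 ≤ κ) :
    HasCorrectors α h |θ| θ l κ := by
  refine ⟨0, le_rfl, fun y => ⟨fun _ => θ, fun x => θ * x, fun x => ?_, fun _ => le_rfl,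
    fun x₀ s hs => ?_, fun x => ?_, ?_⟩⟩
  · simpa using (hasDerivAt_id x).const_mul θ
  · refine Eventually.of_forall fun x => ?_
    have : 0 ≤ s := le_trans (div_nonneg (by linarith [hl x₀]) (hα x₀).le) hs.le
    have : 0 ≤ s * (x - x₀) ^ 2 := by positivity
    simpa using this
  · have := mul_nonneg hκ (abs_nonneg x)
    have := mul_nonneg hκ (abs_nonneg y)
    linarith
  · have := mul_nonneg hκ (abs_nonneg y)
    linarith

end Comparison

/-- The equation has approximate correctors of slope `θ` at level `k`, from above and from below. -/
def HasLevel (α : ℝ → ℝ) (h : ℝ → ℝ → ℝ) (R θ k : ℝ) : Prop :=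
  (∀ κ > 0, HasCorrectors α h R θ k κ) ∧
    ∀ κ > 0, HasCorrectors α (fun p x => -h (-p) x) R (-θ) (-k) κ

theorem HasCorrectors.mono_radius {α : ℝ → ℝ} {h : ℝ → ℝ → ℝ} {R R' θ k κ : ℝ}
    (hc : HasCorrectors α h R θ k κ) (hR : R ≤ R') : HasCorrectors α h R' θ k κ := by
  obtain ⟨C, hC, H⟩ := hc
  refine ⟨C, hC, fun y => ?_⟩
  obtain ⟨f, F, h1, h2, h3⟩ := H y
  exact ⟨f, F, h1, fun x => (h2 x).trans hR, h3⟩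

theorem HasLevel.mono {α : ℝ → ℝ} {h : ℝ → ℝ → ℝ} {R R' θ k : ℝ} (hl : HasLevel α h R θ k)
    (hR : R ≤ R') : HasLevel α h R' θ k :=
  ⟨fun κ hκ => (hl.1 κ hκ).mono_radius hR, fun κ hκ => (hl.2 κ hκ).mono_radius hR⟩

theorem le_of_forall_mul_le {A B D : ℝ} (h : ∀ t, 0 ≤ t → A * t ≤ B * t + D) : A ≤ B := by
  by_contra hcon
  have h1 := h ((|D| + 1) / (A - B)) (by have := not_le.1 hcon; positivity)
  have h2 : (A - B) * ((|D| + 1) / (A - B)) = |D| + 1 := by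
    have : A - B ≠ 0 := by have := not_le.1 hcon; linarith
    field_simp
  linarith [le_abs_self D]

section Level

variable {α : ℝ → ℝ} {h : ℝ → ℝ → ℝ} {v : ℝ → ℝ → ℝ} {R L K k k' g θ θ' κ β : ℝ}

theorem HasLevel.abs_sub_le (hα0 : ∀ x, 0 < α x) (hα1 : ∀ x, α x ≤ 1)
    (hv : IsViscositySolution α h v)
    (huc : UniformContinuousOn (fun q : ℝ × ℝ => v q.1 q.2) {q : ℝ × ℝ | 0 ≤ q.1})
    (hinit : ∀ x, v 0 x = θ' * x)
    (hlip : ∀ p q x, |p| ≤ L → |q| ≤ L → |h p x - h q x| ≤ K * |p - q|) (hK : 0 ≤ K)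
    (hl : HasLevel α h R θ k) (hκ : 0 < κ) (hβ : κ + |θ - θ'| ≤ β) (hR : R + 2 * β ≤ L) :
    ∃ D, 0 ≤ D ∧ ∀ t y, 0 ≤ t →
      |v t y - (θ' * y + k * t)| ≤ β * ((5 + 2 * K) * (|y| + t)) + D := by
  obtain ⟨D₁, hD₁, h₁⟩ := hv.1.le_of_hasCorrectors hα0 hα1 huc hinit hlip hK (hl.1 κ hκ) hκ hβ hR
  obtain ⟨D₂, hD₂, h₂⟩ := hv.2.neg.le_of_hasCorrectors (θ' := -θ') hα0 hα1 (uniformContinuous_neg.comp_uniformContinuousOn huc)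
    (fun x => by rw [hinit]; ring)
    (fun p q x hp hq => by
      have := hlip (-q) (-p) x (by rwa [abs_neg]) (by rwa [abs_neg])
      rwa [neg_sub_neg] at this ⊢) hK (hl.2 κ hκ) hκ
    (by rwa [neg_sub_neg, abs_sub_comm]) hR
  refine ⟨D₁ + D₂, by positivity, fun t y ht => abs_le.2 ⟨?_, ?_⟩⟩
  · linarith [h₂ t y ht]
  · linarith [h₁ t y ht]

/-- Levels depend on the slope in a Lipschitz way. -/
theorem HasLevel.level_lipschitz {M : ℝ} (hα0 : ∀ x, 0 < α x) (hα1 : ∀ x, α x ≤ 1)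
    (hv : IsViscositySolution α h v)
    (huc : UniformContinuousOn (fun q : ℝ × ℝ => v q.1 q.2) {q : ℝ × ℝ | 0 ≤ q.1})
    (hinit : ∀ x, v 0 x = θ' * x) (hθ : |θ| ≤ M) (hθ' : |θ'| ≤ M)
    (hlip : ∀ p q x, |p| ≤ L → |q| ≤ L → |h p x - h q x| ≤ K * |p - q|) (hK : 0 ≤ K)
    (hl : HasLevel α h R θ k) (hl' : HasLevel α h R θ' k') (hL : R + 2 * (1 + 2 * M) ≤ L) :
    |k - k'| ≤ (5 + 2 * K) * |θ - θ'| := by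
  have hd : |θ - θ'| ≤ 2 * M := (abs_sub _ _).trans (by linarith)
  have key : ∀ κ, 0 < κ → κ ≤ 1 → |k - k'| ≤ (2 * κ + |θ - θ'|) * (5 + 2 * K) := by
    intro κ hκ hκ1
    obtain ⟨D₁, hD₁, h₁⟩ := hl.abs_sub_le (θ' := θ') hα0 hα1 hv huc hinit hlip hK hκ le_rfl
      (by linarith)
    obtain ⟨D₂, hD₂, h₂⟩ := hl'.abs_sub_le (θ' := θ') (β := κ) hα0 hα1 hv huc hinit hlip hK hκ
      (by simp) (by linarith [(abs_nonneg θ).trans hθ])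
    refine le_of_forall_mul_le (D := D₁ + D₂) fun t ht => ?_
    have a1 := abs_le.1 (h₁ t 0 ht)
    have a2 := abs_le.1 (h₂ t 0 ht)
    rw [abs_zero] at a1 a2
    rw [← abs_of_nonneg ht, ← abs_mul, abs_of_nonneg ht]
    exact abs_le.2 ⟨by linarith, by linarith⟩
  refine le_of_forall_pos_le_add fun ε hε => ?_
  have h1 := key (min 1 (ε / (2 * (5 + 2 * K)))) (by positivity) (min_le_left _ _)
  have h2 : min 1 (ε / (2 * (5 + 2 * K))) * (2 * (5 + 2 * K)) ≤ ε := by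
    rw [← le_div_iff₀ (by positivity)]
    exact min_le_right _ _
  linarith

/-- A lower bound of the Hamiltonian at slope `θ` is a lower bound for the level. -/
theorem HasLevel.le_level (hα0 : ∀ x, 0 < α x) (hα1 : ∀ x, α x ≤ 1)
    (hv : IsViscositySolution α h v)
    (huc : UniformContinuousOn (fun q : ℝ × ℝ => v q.1 q.2) {q : ℝ × ℝ | 0 ≤ q.1})
    (hinit : ∀ x, v 0 x = θ * x) (hθR : |θ| ≤ R)
    (hlip : ∀ p q x, |p| ≤ R + 2 → |q| ≤ R + 2 → |h p x - h q x| ≤ K * |p - q|) (hK : 0 ≤ K)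
    (hl : HasLevel α h R θ k) (hg : ∀ x, g ≤ h θ x) : g ≤ k := by
  have key : ∀ κ, 0 < κ → κ ≤ 1 → g ≤ k + (2 * κ) * (5 + 2 * K) := by
    intro κ hκ hκ1
    obtain ⟨D₁, hD₁, h₁⟩ := hv.1.le_of_hasCorrectors (β := κ) hα0 hα1 huc hinit hlip hK
      (hl.1 κ hκ) hκ (by simp) (by linarith)
    obtain ⟨D₂, hD₂, h₂⟩ := hv.2.neg.le_of_hasCorrectors (β := κ) (θ' := -θ) (θ := -θ)
      (R := |-θ|) (k := -g) (L := R + 2) (K := K) (κ := κ) hα0 hα1 (uniformContinuous_neg.comp_uniformContinuousOn huc)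
      (fun x => by rw [hinit]; ring)
      (fun p q x hp hq => by
        have := hlip (-q) (-p) x (by rwa [abs_neg]) (by rwa [abs_neg])
        rwa [neg_sub_neg] at this ⊢) hK
      (hasCorrectors_linear hα0 (fun x => by rw [neg_neg]; linarith [hg x]) hκ.le) hκ
      (by simp) (by rw [abs_neg]; linarith)
    refine le_of_forall_mul_le (D := D₁ + D₂) fun t ht => ?_
    have a1 := h₁ t 0 ht
    have a2 := h₂ t 0 ht
    rw [abs_zero] at a1 a2
    linarith
  refine le_of_forall_pos_le_add fun ε hε => ?_
  have h1 := key (min 1 (ε / (2 * (5 + 2 * K)))) (by positivity) (min_le_left _ _)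
  have h2 : min 1 (ε / (2 * (5 + 2 * K))) * (2 * (5 + 2 * K)) ≤ ε := by
    rw [← le_div_iff₀ (by positivity)]
    exact min_le_right _ _
  linarith

end Level

theorem HJSetting.exists_lipschitz {Ω : Type} [MeasurableSpace Ω] {P : Measure Ω}
    {τ : ℝ → Ω → Ω} {a : ℝ → Ω → ℝ} {H : ℝ → ℝ → Ω → ℝ} {G_L G_U : ℝ → ℝ}
    (h : HJSetting P τ a H G_L G_U) {L : ℝ} (hL : 0 < L) :
    ∃ K, 0 ≤ K ∧ ∀ ω p q x, |p| ≤ L → |q| ≤ L → |H p x ω - H q x ω| ≤ K * |p - q| := by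
  obtain ⟨K, hK, hlip⟩ := h.H_lip L hL
  refine ⟨K, hK.le, fun ω p q x hp hq => ?_⟩
  rw [h.H_stat p, h.H_stat q]
  exact hlip p q _ hp hq

theorem homogenization_linear_initial_data
    {Ω : Type} [MeasurableSpace Ω] (P : Measure Ω) (τ : ℝ → Ω → Ω)
    (a : ℝ → Ω → ℝ) (H : ℝ → ℝ → Ω → ℝ) (G_L G_U : ℝ → ℝ)
    (hset : HJSetting P τ a H G_L G_U)
    (u : ℝ → Ω → ℝ → ℝ → ℝ)
    (hu_sol : ∀ θ ω, IsViscositySolution (fun x => a x ω) (fun p x => H p x ω) (u θ ω))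
    (hu_uc : ∀ θ ω, UniformContinuousOn (fun q : ℝ × ℝ => u θ ω q.1 q.2) {q : ℝ × ℝ | 0 ≤ q.1})
    (hu_init : ∀ θ ω x, u θ ω 0 x = θ * x)
    (hu_unique : ∀ θ ω (v : ℝ → ℝ → ℝ),
      IsViscositySolution (fun x => a x ω) (fun p x => H p x ω) v →
      UniformContinuousOn (fun q : ℝ × ℝ => v q.1 q.2) {q : ℝ × ℝ | 0 ≤ q.1} →
      (∀ x, v 0 x = θ * x) → ∀ t x, 0 ≤ t → v t x = u θ ω t x)
    (hu_lip : ∀ θ ω, ∃ ℓ > (0:ℝ), ∀ t ≥ (0:ℝ), ∀ x y : ℝ,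
      |u θ ω t x - u θ ω t y| ≤ ℓ * |x - y|) :
    ∃ Hbar : ℝ → ℝ,
      Tendsto Hbar (cocompact ℝ) atTop ∧
      (∀ R > (0:ℝ), ∃ K : NNReal, LipschitzOnWith K Hbar (Icc (-R) R)) ∧
      ∃ Ω₀ : Set Ω, MeasurableSet Ω₀ ∧ P Ω₀ = 1 ∧
        ∀ ω ∈ Ω₀, ∀ θ : ℝ, ∀ T > (0:ℝ), ∀ M > (0:ℝ), ∀ η > (0:ℝ), ∃ ε₀ > (0:ℝ),
          ∀ ε : ℝ, 0 < ε → ε < ε₀ → ∀ t ∈ Icc (0:ℝ) T, ∀ x ∈ Icc (-M) M,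
            |ε * u θ ω (t / ε) (x / ε) - (t * Hbar θ + θ * x)| ≤ η := by
  have := hset.prob
  choose R hRn hlev using fun n : ℕ => hset.exists_level (M := n + 1) (by positivity)
  have hlev' : ∀ (n : ℕ) (θ : ℝ), |θ| ≤ n + 1 → ∃ k, ∀ᵐ ω ∂P,
      HasLevel (fun x => a x ω) (fun p x => H p x ω) (R n) θ k := fun n θ hθ => by
    obtain ⟨k, h1, h2⟩ := hlev n θ hθ
    exact ⟨k, h1.and h2⟩
  have hceil : ∀ θ : ℝ, |θ| ≤ (⌈|θ|⌉₊ : ℝ) + 1 := fun θ => by linarith [Nat.le_ceil |θ|]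
  choose Hbar hHbar using fun θ : ℝ => hlev' ⌈|θ|⌉₊ θ (hceil θ)
  have hR0 : ∀ n, 0 < R n := fun n => lt_trans (by positivity) (hRn n)
  have hall : ∀ (n : ℕ) (θ : ℝ), |θ| ≤ n + 1 → ∀ᵐ ω ∂P,
      HasLevel (fun x => a x ω) (fun p x => H p x ω) (R n) θ (Hbar θ) := by
    intro n θ hθ
    obtain ⟨k, hk⟩ := hlev' n θ hθ
    obtain ⟨ω, hω, hω'⟩ := (hk.and (hHbar θ)).exists
    set R' := max (R n) (R ⌈|θ|⌉₊) with hR'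
    have hR'0 : 0 < R' := (hR0 n).trans_le (le_max_left _ _)
    obtain ⟨K, hK, hlip⟩ := hset.exists_lipschitz (L := R' + 2 * (1 + 2 * |θ|)) (by positivity)
    have := (hω.mono (le_max_left _ _)).level_lipschitz (fun x => hset.a_pos x ω)
      (fun x => hset.a_le_one x ω) (hu_sol θ ω) (hu_uc θ ω) (hu_init θ ω) le_rfl le_rfl (hlip ω)
      hK (hω'.mono (le_max_right _ _)) le_rfl
    rw [sub_self, abs_zero, mul_zero] at this
    have : k = Hbar θ := sub_eq_zero.1 (abs_nonpos_iff.1 this)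
    rwa [← this]
  have hLip : ∀ n : ℕ, ∃ c, 0 ≤ c ∧ ∀ θ θ' : ℝ, |θ| ≤ n + 1 → |θ'| ≤ n + 1 →
      |Hbar θ - Hbar θ'| ≤ c * |θ - θ'| := by
    intro n
    have := hR0 n
    obtain ⟨K, hK, hlip⟩ := hset.exists_lipschitz (L := R n + 2 * (1 + 2 * ((n : ℝ) + 1)))
      (by positivity)
    refine ⟨5 + 2 * K, by positivity, fun θ θ' hθ hθ' => ?_⟩
    obtain ⟨ω, hω, hω'⟩ := ((hall n θ hθ).and (hall n θ' hθ')).exists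
    exact hω.level_lipschitz (fun x => hset.a_pos x ω)
      (fun x => hset.a_le_one x ω) (hu_sol θ' ω) (hu_uc θ' ω) (hu_init θ' ω) hθ hθ' (hlip ω)
      hK hω' le_rfl
  refine ⟨Hbar, ?_, fun r hr => ?_, ?_⟩
  · have hG : Tendsto G_L (cocompact ℝ) atTop := by
      have : G_L = fun θ => G_L ‖θ‖ := by
        funext θ
        exact le_antisymm (hset.GL_le (by simp)) (hset.GL_le (by simp))
      rw [this]
      exact hset.GL_coercive.comp (tendsto_norm_cocompact_atTop (E := ℝ))
    refine tendsto_atTop_mono (fun θ => ?_) hG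
    obtain ⟨ω, hω⟩ := (hHbar θ).exists
    have := hR0 ⌈|θ|⌉₊
    obtain ⟨K, hK, hlip⟩ := hset.exists_lipschitz (L := R ⌈|θ|⌉₊ + 2) (by positivity)
    exact hω.le_level (fun x => hset.a_pos x ω)
      (fun x => hset.a_le_one x ω) (hu_sol θ ω) (hu_uc θ ω) (hu_init θ ω)
      ((hceil θ).trans (hRn _).le) (hlip ω) hK
      fun x => by
        rw [hset.H_stat]
        exact hset.H_lower _ _
  · obtain ⟨c, hc, hcl⟩ := hLip ⌈r⌉₊
    have hr' := Nat.le_ceil r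
    refine ⟨c.toNNReal, LipschitzOnWith.of_dist_le_mul fun x hx y hy => ?_⟩
    rw [Real.coe_toNNReal _ hc]
    exact hcl x y (abs_le.2 ⟨by linarith [hx.1], by linarith [hx.2]⟩)
      (abs_le.2 ⟨by linarith [hy.1], by linarith [hy.2]⟩)
  have hae : ∀ᵐ ω ∂P, ∀ (n : ℕ) (q : ℚ), |(q : ℝ)| ≤ n + 1 →
      HasLevel (fun x => a x ω) (fun p x => H p x ω) (R n) q (Hbar q) :=
    ae_all_iff.2 fun n => ae_all_iff.2 fun q => by
      by_cases hq : |(q : ℝ)| ≤ n + 1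
      · filter_upwards [hall n q hq] with ω hω _ using hω
      · exact Eventually.of_forall fun ω h => absurd h hq
  set E := {ω | ∀ (n : ℕ) (q : ℚ), |(q : ℝ)| ≤ n + 1 →
    HasLevel (fun x => a x ω) (fun p x => H p x ω) (R n) q (Hbar q)} with hE
  have hE0 : P (toMeasurable P Eᶜ) = 0 := by
    rw [measure_toMeasurable]
    exact hae
  refine ⟨(toMeasurable P Eᶜ)ᶜ, (measurableSet_toMeasurable P Eᶜ).compl,
    (prob_compl_eq_one_iff (measurableSet_toMeasurable P Eᶜ)).2 hE0,
    fun ω hω θ T hT M hM η hη => ?_⟩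
  have hωE : ω ∈ E := by
    by_contra hcon
    exact hω (subset_toMeasurable P Eᶜ hcon)
  set n := ⌈|θ|⌉₊ with hn
  have hθn : |θ| ≤ n := Nat.le_ceil _
  have hRpos := hR0 n
  obtain ⟨c, hc, hcl⟩ := hLip n
  obtain ⟨K, hK, hlip⟩ := hset.exists_lipschitz (L := R n + 4) (by positivity)
  set A := T * c + 2 * ((5 + 2 * K) * (M + T)) with hA
  have hA0 : 0 ≤ A := by positivity
  set β := min 1 (η / (2 * (A + 1))) with hβ
  have hβ0 : 0 < β := lt_min one_pos (by positivity)
  have hβ1 : β ≤ 1 := min_le_left _ _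
  have hβA : β * A ≤ η / 2 := by
    have : β ≤ η / (2 * (A + 1)) := min_le_right _ _
    rw [le_div_iff₀ (by positivity)] at this
    linarith
  obtain ⟨q, hq1, hq2⟩ := exists_rat_btwn (show θ < θ + β by linarith)
  have hqθ : |(q : ℝ) - θ| ≤ β := abs_le.2 ⟨by linarith, by linarith⟩
  have hqn : |(q : ℝ)| ≤ n + 1 := by
    have := abs_add_le ((q : ℝ) - θ) θ
    rw [sub_add_cancel] at this
    linarith
  have hHq : |Hbar q - Hbar θ| ≤ c * β :=
    (hcl q θ hqn (by linarith)).trans (mul_le_mul_of_nonneg_left hqθ hc)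
  obtain ⟨D, hD, hmain⟩ := (hωE n q hqn).abs_sub_le (β := 2 * β) (fun x => hset.a_pos x ω)
    (fun x => hset.a_le_one x ω) (hu_sol θ ω) (hu_uc θ ω) (hu_init θ ω) (hlip ω) hK hβ0
    (by linarith) (by linarith)
  refine ⟨η / (2 * (D + 1)), by positivity, fun ε hε hε' t ht x hx => ?_⟩
  rw [lt_div_iff₀ (by positivity)] at hε'
  have h1 := mul_le_mul_of_nonneg_left (hmain (t / ε) (x / ε) (div_nonneg ht.1 hε.le)) hε.le
  have e1 : ε * |u θ ω (t / ε) (x / ε) - (θ * (x / ε) + Hbar q * (t / ε))| =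
      |ε * u θ ω (t / ε) (x / ε) - (θ * x + Hbar q * t)| := by
    rw [← abs_of_pos hε, ← abs_mul, abs_of_pos hε]
    congr 1
    field_simp
  have e2 : ε * (2 * β * ((5 + 2 * K) * (|x / ε| + t / ε)) + D) =
      2 * β * ((5 + 2 * K) * (|x| + t)) + ε * D := by
    rw [abs_div, abs_of_pos hε]
    field_simp
  rw [e1, e2] at h1
  have hx' : |x| ≤ M := abs_le.2 hx
  have h2 : 2 * β * ((5 + 2 * K) * (|x| + t)) ≤ 2 * β * ((5 + 2 * K) * (M + T)) := by
    have := ht.2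
    gcongr
  have h3 : |t * (Hbar q - Hbar θ)| ≤ T * (c * β) := by
    rw [abs_mul, abs_of_nonneg ht.1]
    exact mul_le_mul ht.2 hHq (abs_nonneg _) hT.le
  have h4 : |ε * u θ ω (t / ε) (x / ε) - (t * Hbar θ + θ * x)| ≤
      |ε * u θ ω (t / ε) (x / ε) - (θ * x + Hbar q * t)| + |t * (Hbar q - Hbar θ)| := by
    refine le_trans (le_of_eq ?_) (abs_add_le _ _)
    congr 1
    ring
  have h5 : β * A = T * (c * β) + 2 * β * ((5 + 2 * K) * (M + T)) := by
    rw [hA]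
    ring
  linarith
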